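/- arXiv:math/9911037 — 2 statements merged into one kernel-verified Lean document; each statement's English description precedes it below -/
import Mathlib

section
/- The Banach space X (the completion of c₀₀(T) with respect to the norm ‖·‖_X) is 2-β: for every ε > 0 there exists δ with 0 < δ < 1 such that for every x in the closed unit ball B of X and every ε-separated sequence (x_n) ⊆ B there are indices n₁ < n₂ with ‖x + x_{n₁} + x_{n₂}‖_X/3 ≤ 1 − δ. -/
open scoped BigOperators

/-- A node of the dyadic tree `T = ⋃ₙ {0,1}ⁿ`, modelled as a finite list of booleans.
The tree order `φ ≤ ψ` is the prefix order `φ <+: ψ`; the length of a node is its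
list length. -/
abbrev Node : Type := List Bool

/-- The subtree `T_φ` consisting of all nodes `ψ` with `φ ≤ ψ`. -/
def Tsub (φ : Node) : Set Node := {ψ | φ <+: ψ}

/-- `S_φ`: the set of nodes extending `φ` by zeroes (`false`s) only. -/
def Sset (φ : Node) : Set Node := {ψ | ∃ k : ℕ, ψ = φ ++ List.replicate k false}

/-- Two nodes are incomparable if neither is a prefix of the other. -/
def Incomparable (φ ψ : Node) : Prop := ¬ φ <+: ψ ∧ ¬ ψ <+: φ

/-- A finite set `A ⊆ T` is admissible if there is `n` such that every element of `A`
lies in some subtree `T_σ` with `|σ| = n`, and each such subtree contains at most one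
element of `A`. -/
def Admissible (A : Finset Node) : Prop :=
  ∃ n : ℕ,
    (∀ φ ∈ A, ∃ σ : Node, σ.length = n ∧ σ <+: φ) ∧
    (∀ σ : Node, σ.length = n → ∀ φ ∈ A, ∀ ψ ∈ A, σ <+: φ → σ <+: ψ → φ = ψ)

/-- A finite set `A ⊆ T` is acceptable if there is `n` such that every element of `A`
lies in some set `S_σ` with `|σ| = n`, and each such set contains at most one
element of `A`. -/
def Acceptable (A : Finset Node) : Prop :=
  ∃ n : ℕ,
    (∀ φ ∈ A, ∃ σ : Node, σ.length = n ∧ φ ∈ Sset σ) ∧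
    (∀ σ : Node, σ.length = n → ∀ φ ∈ A, ∀ ψ ∈ A, φ ∈ Sset σ → ψ ∈ Sset σ → φ = ψ)

/-- `Before A B` is the relation `A ≪ B`: every node of `A` is strictly shorter than
every node of `B`. -/
def Before (A B : Finset Node) : Prop :=
  ∀ φ ∈ A, ∀ ψ ∈ B, φ.length < ψ.length

/-- The norm `‖·‖_X` on `c₀₀(T)` (finitely supported functions on the tree, modelled
as `Node →₀ ℝ`): the supremum of `(∑ᵢ (∑_{φ ∈ Aᵢ} |x φ|)²)^{1/2}` over all finite
chains `A₁ ≪ ⋯ ≪ A_k` of admissible sets. -/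
noncomputable def normX (x : Node →₀ ℝ) : ℝ :=
  sSup { r : ℝ | ∃ (k : ℕ) (A : Fin k → Finset Node),
    (∀ i, Admissible (A i)) ∧ (∀ i j : Fin k, i < j → Before (A i) (A j)) ∧
    r = Real.sqrt (∑ i, (∑ φ ∈ A i, |x φ|) ^ 2) }

/-- The norm `‖·‖_Y` on `c₀₀(T)`: as `normX` but with acceptable sets. -/
noncomputable def normY (x : Node →₀ ℝ) : ℝ :=
  sSup { r : ℝ | ∃ (k : ℕ) (A : Fin k → Finset Node),
    (∀ i, Acceptable (A i)) ∧ (∀ i j : Fin k, i < j → Before (A i) (A j)) ∧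
    r = Real.sqrt (∑ i, (∑ φ ∈ A i, |x φ|) ^ 2) }

/-- The characteristic function `χ_A` of a finite set of nodes, as an element of
`c₀₀(T)`. -/
noncomputable def chi (A : Finset Node) : Node →₀ ℝ :=
  Finsupp.indicator A fun _ _ => (1 : ℝ)

open Classical in
/-- The sup norm `‖y·χ_S‖_∞` of the restriction of `y` to a set `S` of nodes. -/
noncomputable def supOn (y : Node →₀ ℝ) (S : Set Node) : ℝ :=
  sSup (Set.range fun ψ : Node => if ψ ∈ S then |y ψ| else 0)

/-- A branch of the dyadic tree, identified with an infinite 0-1 sequence. -/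
abbrev Branch : Type := ℕ → Bool

/-- The node of length `n` on the branch `γ`. -/
def branchNode (γ : Branch) (n : ℕ) : Node := List.ofFn fun i : Fin n => γ i

/-- A branch `γ` passes through the node `φ` iff `φ ∈ γ`. -/
def PassesThrough (γ : Branch) (φ : Node) : Prop := branchNode γ φ.length = φ

/-- A sequence is `ε`-separated: `inf {‖x_n - x_m‖ : m ≠ n} ≥ ε`. -/
def Separated {Z : Type*} [SeminormedAddGroup Z] (ε : ℝ) (x : ℕ → Z) : Prop :=
  ∀ m n : ℕ, m ≠ n → ε ≤ ‖x m - x n‖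

/-- `ε`-separation with respect to a norm function `N`. -/
def SeparatedWith {Z : Type*} [AddGroup Z] (N : Z → ℝ) (ε : ℝ) (x : ℕ → Z) : Prop :=
  ∀ m n : ℕ, m ≠ n → ε ≤ N (x m - x n)

/-- `N` is a norm on the real vector space `Z`. -/
def IsNormF {Z : Type*} [AddCommGroup Z] [Module ℝ Z] (N : Z → ℝ) : Prop :=
  (∀ x y : Z, N (x + y) ≤ N x + N y) ∧
  (∀ (a : ℝ) (x : Z), N (a • x) = |a| * N x) ∧
  (∀ x : Z, N x = 0 → x = 0)

/-- The `2`-NUC property with respect to a norm function `N`. -/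
def TwoNUCWith {Z : Type*} [AddCommGroup Z] (N : Z → ℝ) : Prop :=
  ∀ ε : ℝ, 0 < ε → ∃ δ : ℝ, 0 < δ ∧ δ < 1 ∧
    ∀ u : ℕ → Z, (∀ n, N (u n) ≤ 1) → SeparatedWith N ε u →
      ∃ n₁ n₂ : ℕ, n₁ < n₂ ∧ N (u n₁ + u n₂) / 2 ≤ 1 - δ

/-- The `1`-β property with respect to a norm function `N`. -/
def OneBetaWith {Z : Type*} [AddCommGroup Z] (N : Z → ℝ) : Prop :=
  ∀ ε : ℝ, 0 < ε → ∃ δ : ℝ, 0 < δ ∧ δ < 1 ∧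
    ∀ x : Z, N x ≤ 1 → ∀ u : ℕ → Z, (∀ n, N (u n) ≤ 1) → SeparatedWith N ε u →
      ∃ n : ℕ, N (x + u n) / 2 ≤ 1 - δ

/-- The property `k`-β of a Banach space. -/
def kBeta (k : ℕ) (Z : Type*) [NormedAddCommGroup Z] : Prop :=
  ∀ ε : ℝ, 0 < ε → ∃ δ : ℝ, 0 < δ ∧ δ < 1 ∧
    ∀ x : Z, ‖x‖ ≤ 1 → ∀ u : ℕ → Z, (∀ n, ‖u n‖ ≤ 1) → Separated ε u →
      ∃ ι : Fin k → ℕ, StrictMono ι ∧ ‖x + ∑ i, u (ι i)‖ / ((k : ℝ) + 1) ≤ 1 - δ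

/-- The property `k`-NUC of a Banach space. -/
def kNUC (k : ℕ) (Z : Type*) [NormedAddCommGroup Z] : Prop :=
  ∀ ε : ℝ, 0 < ε → ∃ δ : ℝ, 0 < δ ∧ δ < 1 ∧
    ∀ u : ℕ → Z, (∀ n, ‖u n‖ ≤ 1) → Separated ε u →
      ∃ ι : Fin k → ℕ, StrictMono ι ∧ ‖∑ i, u (ι i)‖ / (k : ℝ) ≤ 1 - δ

/-- Nearly uniform convexity. -/
def NUC (Z : Type*) [NormedAddCommGroup Z] [NormedSpace ℝ Z] : Prop :=
  ∀ ε : ℝ, 0 < ε → ∃ δ : ℝ, δ < 1 ∧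
    ∀ u : ℕ → Z, (∀ n, ‖u n‖ ≤ 1) → Separated ε u →
      ∃ y ∈ convexHull ℝ (Set.range u), ‖y‖ ≤ δ

/-- The nodes of length less than `N`. -/
noncomputable def shortNodes (N : ℕ) : Finset Node := (List.finite_length_lt Bool N).toFinset

/-- The nodes of length exactly `N`. -/
noncomputable def levelNodes (N : ℕ) : Finset Node := (List.finite_length_eq Bool N).toFinset

@[simp] lemma mem_shortNodes {N : ℕ} {φ : Node} : φ ∈ shortNodes N ↔ φ.length < N := by
  simp [shortNodes]

@[simp] lemma mem_levelNodes {N : ℕ} {φ : Node} : φ ∈ levelNodes N ↔ φ.length = N := by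
  simp [levelNodes]

/-- Chains `A₁ ≪ ⋯ ≪ A_k` of admissible sets. -/
def IsChainX {k : ℕ} (A : Fin k → Finset Node) : Prop :=
  (∀ i, Admissible (A i)) ∧ ∀ i j : Fin k, i < j → Before (A i) (A j)

lemma Before.mono {A A' B B' : Finset Node} (h : Before A B) (hA : A' ⊆ A) (hB : B' ⊆ B) :
    Before A' B' := fun φ hφ ψ hψ => h φ (hA hφ) ψ (hB hψ)

lemma Admissible.mono {A B : Finset Node} (h : Admissible B) (hAB : A ⊆ B) : Admissible A := by
  obtain ⟨n, h1, h2⟩ := h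
  exact ⟨n, fun φ hφ => h1 φ (hAB hφ),
    fun σ hσ φ hφ ψ hψ => h2 σ hσ φ (hAB hφ) ψ (hAB hψ)⟩

lemma admissible_empty : Admissible ∅ := ⟨0, by simp, by simp⟩

lemma IsChainX.pairwiseDisjoint {k : ℕ} {A : Fin k → Finset Node} (h : IsChainX A) :
    (Set.univ : Set (Fin k)).PairwiseDisjoint A := by
  intro i _ j _ hij
  rw [Function.onFun, Finset.disjoint_left]
  intro φ hi hj
  rcases lt_or_gt_of_ne hij with h' | h'
  · exact lt_irrefl _ (h.2 i j h' φ hi φ hj)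
  · exact lt_irrefl _ (h.2 j i h' φ hj φ hi)

lemma sum_abs_le_support (x : Node →₀ ℝ) (B : Finset Node) :
    ∑ φ ∈ B, |x φ| ≤ ∑ φ ∈ x.support, |x φ| := by
  classical
  calc ∑ φ ∈ B, |x φ| ≤ ∑ φ ∈ B ∪ x.support, |x φ| :=
        Finset.sum_le_sum_of_subset_of_nonneg Finset.subset_union_left
          fun _ _ _ => abs_nonneg _
    _ = ∑ φ ∈ x.support, |x φ| := by
        symm
        apply Finset.sum_subset Finset.subset_union_right
        intro φ _ hφ
        simp [Finsupp.notMem_support_iff.1 hφ]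

lemma IsChainX.sqrt_le {k : ℕ} {A : Fin k → Finset Node} (h : IsChainX A) (x : Node →₀ ℝ) :
    Real.sqrt (∑ i, (∑ φ ∈ A i, |x φ|) ^ 2) ≤ ∑ φ ∈ x.support, |x φ| := by
  classical
  have h0 : ∀ i, 0 ≤ ∑ φ ∈ A i, |x φ| := fun i => Finset.sum_nonneg fun _ _ => abs_nonneg _
  have h1 : ∑ i, ∑ φ ∈ A i, |x φ| ≤ ∑ φ ∈ x.support, |x φ| := by
    rw [← Finset.sum_biUnion]
    · exact sum_abs_le_support x _
    · simpa using h.pairwiseDisjoint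
  refine le_trans ?_ h1
  rw [Real.sqrt_le_left (Finset.sum_nonneg fun i _ => h0 i)]
  exact Finset.sum_sq_le_sq_sum_of_nonneg fun i _ => h0 i

lemma normX_bddAbove (x : Node →₀ ℝ) :
    BddAbove { r : ℝ | ∃ (k : ℕ) (A : Fin k → Finset Node),
      (∀ i, Admissible (A i)) ∧ (∀ i j : Fin k, i < j → Before (A i) (A j)) ∧
      r = Real.sqrt (∑ i, (∑ φ ∈ A i, |x φ|) ^ 2) } := by
  refine ⟨∑ φ ∈ x.support, |x φ|, ?_⟩
  rintro r ⟨k, A, h1, h2, rfl⟩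
  exact IsChainX.sqrt_le ⟨h1, h2⟩ x

lemma normX_nonneg (x : Node →₀ ℝ) : 0 ≤ normX x := by
  apply Real.sSup_nonneg
  rintro r ⟨k, A, h1, h2, rfl⟩
  exact Real.sqrt_nonneg _

lemma IsChainX.sum_sq_le {k : ℕ} {A : Fin k → Finset Node} (h : IsChainX A) (x : Node →₀ ℝ) :
    ∑ i, (∑ φ ∈ A i, |x φ|) ^ 2 ≤ normX x ^ 2 := by
  rw [← Real.sqrt_le_left (normX_nonneg x)]
  exact le_csSup (normX_bddAbove x) ⟨k, A, h.1, h.2, rfl⟩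

lemma normX_le_of_chains {x : Node →₀ ℝ} {D : ℝ} (hD : 0 ≤ D)
    (h : ∀ (k : ℕ) (A : Fin k → Finset Node), IsChainX A →
      ∑ i, (∑ φ ∈ A i, |x φ|) ^ 2 ≤ D ^ 2) : normX x ≤ D := by
  apply Real.sSup_le _ hD
  rintro r ⟨k, A, h1, h2, rfl⟩
  rw [Real.sqrt_le_left hD]
  exact h k A ⟨h1, h2⟩

lemma normX_sq_le_of_chains {x : Node →₀ ℝ} {D : ℝ}
    (h : ∀ (k : ℕ) (A : Fin k → Finset Node), IsChainX A →
      ∑ i, (∑ φ ∈ A i, |x φ|) ^ 2 ≤ D) : normX x ^ 2 ≤ D := by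
  have hD : 0 ≤ D := by
    simpa using h 0 (fun _ => ∅) ⟨fun i => i.elim0, fun i => i.elim0⟩
  rw [← Real.le_sqrt (normX_nonneg x) hD]
  refine normX_le_of_chains (Real.sqrt_nonneg _) fun k A hA => ?_
  rw [Real.sq_sqrt hD]
  exact h k A hA

lemma normX_le_sum_of_support {x : Node →₀ ℝ} {s : Finset Node} (hs : x.support ⊆ s) :
    normX x ≤ ∑ φ ∈ s, |x φ| := by
  have h0 : 0 ≤ ∑ φ ∈ s, |x φ| := Finset.sum_nonneg fun _ _ => abs_nonneg _
  apply Real.sSup_le _ h0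
  rintro r ⟨k, A, h1, h2, rfl⟩
  exact (IsChainX.sqrt_le ⟨h1, h2⟩ x).trans
    (Finset.sum_le_sum_of_subset_of_nonneg hs fun _ _ _ => abs_nonneg _)

lemma Admissible.sum_le {A : Finset Node} (h : Admissible A) (x : Node →₀ ℝ) :
    ∑ φ ∈ A, |x φ| ≤ normX x := by
  have hc : IsChainX (fun _ : Fin 1 => A) :=
    ⟨fun _ => h, fun i j hij => absurd hij (by simp [Subsingleton.elim i j])⟩
  have := hc.sum_sq_le x
  simp only [Fin.sum_univ_one] at this
  exact (abs_le_of_sq_le_sq' this (normX_nonneg x)).2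

lemma admissible_singleton (φ : Node) : Admissible {φ} :=
  ⟨0, fun ψ _ => ⟨[], rfl, List.nil_prefix⟩, by simp +contextual⟩

lemma abs_apply_le_normX (x : Node →₀ ℝ) (φ : Node) : |x φ| ≤ normX x := by
  simpa using (admissible_singleton φ).sum_le x

lemma sum_abs_filter (x : Node →₀ ℝ) (P : Node → Prop) [DecidablePred P] (A : Finset Node) :
    ∑ φ ∈ A, |x.filter P φ| = ∑ φ ∈ A with P φ, |x φ| := by
  rw [Finset.sum_filter]
  refine Finset.sum_congr rfl fun φ _ => ?_
  rw [Finsupp.filter_apply]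
  split_ifs <;> simp

lemma IsChainX.append_filter {k l : ℕ} {A : Fin k → Finset Node} {B : Fin l → Finset Node}
    (hA : IsChainX A) (hB : IsChainX B) (N : ℕ) :
    IsChainX (Fin.append (fun i => (A i).filter fun φ => φ.length < N)
      (fun i => (B i).filter fun φ => N ≤ φ.length)) := by
  constructor
  · intro i
    refine Fin.addCases (fun i => ?_) (fun i => ?_) i
    · rw [Fin.append_left]
      exact (hA.1 i).mono (Finset.filter_subset _ _)
    · rw [Fin.append_right]
      exact (hB.1 i).mono (Finset.filter_subset _ _)
  · intro i j
    refine Fin.addCases (fun i => ?_) (fun i => ?_) i <;>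
      refine Fin.addCases (fun j => ?_) (fun j => ?_) j <;>
      simp only [Fin.append_left, Fin.append_right] <;> intro hij
    · exact (hA.2 i j hij).mono (Finset.filter_subset _ _)
        (Finset.filter_subset _ _)
    · intro φ hφ ψ hψ
      exact (Finset.mem_filter.1 hφ).2.trans_le (Finset.mem_filter.1 hψ).2
    · exact absurd hij (by simp [Fin.lt_def]; omega)
    · exact (hB.2 i j (by simpa using hij)).mono (Finset.filter_subset _ _)
        (Finset.filter_subset _ _)

lemma IsChainX.sum_sq_add_normX_filter_sq_le {k : ℕ} {A : Fin k → Finset Node}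
    (hA : IsChainX A) (x : Node →₀ ℝ) (N : ℕ) :
    ∑ i, (∑ φ ∈ A i with φ.length < N, |x φ|) ^ 2
      + normX (x.filter fun φ => N ≤ φ.length) ^ 2 ≤ normX x ^ 2 := by
  rw [← le_sub_iff_add_le']
  refine normX_sq_le_of_chains fun l B hB => ?_
  have := (hA.append_filter hB N).sum_sq_le x
  rw [Fin.sum_univ_add] at this
  simp only [Fin.append_left, Fin.append_right] at this
  simp only [sum_abs_filter]
  linarith

lemma normX_filter_sq_add_le (x : Node →₀ ℝ) (N : ℕ) :
    normX (x.filter fun φ => φ.length < N) ^ 2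
      + normX (x.filter fun φ => N ≤ φ.length) ^ 2 ≤ normX x ^ 2 := by
  rw [← le_sub_iff_add_le]
  refine normX_sq_le_of_chains fun k A hA => ?_
  simp only [sum_abs_filter]
  linarith [hA.sum_sq_add_normX_filter_sq_le x N]

lemma exists_max_abs_of_prefix (x : Node →₀ ℝ) (σ : Node) :
    ∃ ψ : Node, σ <+: ψ ∧ ∀ φ : Node, σ <+: φ → |x φ| ≤ |x ψ| := by
  classical
  by_cases h : (x.support.filter fun φ => σ <+: φ).Nonempty
  · obtain ⟨ψ, hψ, hmax⟩ := Finset.exists_max_image _ (fun φ => |x φ|) h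
    refine ⟨ψ, (Finset.mem_filter.1 hψ).2, fun φ hφ => ?_⟩
    by_cases hx : x φ = 0
    · simp [hx]
    · exact hmax φ (by simp [hx, hφ])
  · refine ⟨σ, List.prefix_rfl, fun φ hφ => ?_⟩
    by_cases hx : x φ = 0
    · simp [hx]
    · exact absurd ⟨φ, by simp [hx, hφ]⟩ h

/-- A node of `T_σ` at which `|x|` attains its maximum over `T_σ`. -/
noncomputable def peak (x : Node →₀ ℝ) (σ : Node) : Node := (exists_max_abs_of_prefix x σ).choose

lemma prefix_peak (x : Node →₀ ℝ) (σ : Node) : σ <+: peak x σ :=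
  (exists_max_abs_of_prefix x σ).choose_spec.1

lemma abs_le_abs_peak (x : Node →₀ ℝ) {σ φ : Node} (h : σ <+: φ) : |x φ| ≤ |x (peak x σ)| :=
  (exists_max_abs_of_prefix x σ).choose_spec.2 φ h

lemma sum_sq_dist_and_lower {ι : Type*} (s : Finset ι) (a b c d : ι → ℝ) {δ : ℝ}
    (hd0 : ∀ i, 0 ≤ d i)
    (hd : ∀ i, d i ≤ a i + b i + c i) (ha : ∑ i ∈ s, a i ^ 2 ≤ 1) (hb : ∑ i ∈ s, b i ^ 2 ≤ 1)
    (hc : ∑ i ∈ s, c i ^ 2 ≤ 1) (h : (3 - 3 * δ) ^ 2 ≤ ∑ i ∈ s, d i ^ 2) :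
    ∑ i ∈ s, (a i - b i) ^ 2 ≤ 18 * δ ∧ ∑ i ∈ s, (b i - c i) ^ 2 ≤ 18 * δ ∧
      1 - 6 * δ ≤ ∑ i ∈ s, b i ^ 2 := by
  have h1 : ∑ i ∈ s, d i ^ 2 ≤ ∑ i ∈ s, (a i + b i + c i) ^ 2 :=
    Finset.sum_le_sum fun i _ => pow_le_pow_left₀ (hd0 i) (hd i) 2
  have h2 : ∑ i ∈ s, (a i + b i + c i) ^ 2 + (∑ i ∈ s, (a i - b i) ^ 2 +
      ∑ i ∈ s, (b i - c i) ^ 2 + ∑ i ∈ s, (a i - c i) ^ 2) =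
      3 * (∑ i ∈ s, a i ^ 2 + ∑ i ∈ s, b i ^ 2 + ∑ i ∈ s, c i ^ 2) := by
    simp only [← Finset.sum_add_distrib, Finset.mul_sum]
    exact Finset.sum_congr rfl fun i _ => by ring
  have h3 : 0 ≤ ∑ i ∈ s, (a i - b i) ^ 2 := Finset.sum_nonneg fun _ _ => sq_nonneg _
  have h4 : 0 ≤ ∑ i ∈ s, (b i - c i) ^ 2 := Finset.sum_nonneg fun _ _ => sq_nonneg _
  have h5 : 0 ≤ ∑ i ∈ s, (a i - c i) ^ 2 := Finset.sum_nonneg fun _ _ => sq_nonneg _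
  have h6 := sq_nonneg δ
  refine ⟨?_, ?_, ?_⟩ <;> nlinarith

lemma eq_of_prefix_of_length_eq {σ τ χ : Node} (h : σ.length = τ.length) (hσ : σ <+: χ)
    (hτ : τ <+: χ) : σ = τ := by
  rw [List.prefix_iff_eq_take.1 hσ, List.prefix_iff_eq_take.1 hτ, h]

lemma exists_admissible_transfer {A : Finset Node} (hA : Admissible A) {N M : ℕ} (hNM : N ≤ M)
    (hne : ∃ φ ∈ A, φ.length < N) (p r : Node →₀ ℝ) (hp : ∀ φ : Node, M ≤ φ.length → p φ = 0) :
    ∃ A' : Finset Node, Admissible A' ∧ (∀ ψ ∈ A', ψ ∈ A ∨ N ≤ ψ.length) ∧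
      ∑ φ ∈ A, |p φ| + ∑ φ ∈ A with M ≤ φ.length, |r φ| ≤
        ∑ φ ∈ A', |p φ| + ∑ σ ∈ levelNodes N, |(|p (peak p σ)| - |r (peak r σ)|)| := by
  classical
  obtain ⟨n, h1, h2⟩ := hA
  have hlen : ∀ φ ∈ A, n ≤ φ.length := by
    intro φ hφ
    obtain ⟨σ, hσ, hσφ⟩ := h1 φ hφ
    exact hσ ▸ hσφ.length_le
  have hnN : n ≤ N := by
    obtain ⟨φ, hφ, hφN⟩ := hne
    exact (hlen φ hφ).trans hφN.le
  let h : Node → Node := fun φ => if M ≤ φ.length then peak p (φ.take N) else φ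
  have hh : ∀ φ : Node, φ.take n <+: h φ := by
    intro φ
    by_cases hφ : M ≤ φ.length
    · simp only [h, if_pos hφ]
      exact (List.take_prefix_take_left hnN).trans (prefix_peak _ _)
    · simp only [h, if_neg hφ]
      exact List.take_prefix _ _
  have key : ∀ σ : Node, σ.length = n → ∀ φ ∈ A, σ <+: h φ → σ = φ.take n := by
    intro σ hσ φ hφ hσφ
    refine eq_of_prefix_of_length_eq ?_ hσφ (hh φ)
    rw [List.length_take, hσ, min_eq_left (hlen φ hφ)]
  have hlt : ∀ φ ∈ A, (φ.take n).length = n := fun φ hφ => by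
    rw [List.length_take, min_eq_left (hlen φ hφ)]
  have htake : ∀ φ ∈ A, ∀ ψ ∈ A, φ.take n = ψ.take n → φ = ψ := by
    intro φ hφ ψ hψ he
    exact h2 (φ.take n) (hlt φ hφ) φ hφ ψ hψ (List.take_prefix _ _)
      (he ▸ List.take_prefix _ _)
  have hinj : Set.InjOn h A := by
    intro φ hφ ψ hψ he
    exact htake φ hφ ψ hψ (key _ (hlt φ hφ) ψ hψ (he ▸ hh φ))
  refine ⟨A.image h, ⟨n, ?_, ?_⟩, ?_, ?_⟩
  · intro φ hφ
    obtain ⟨φ', hφ', rfl⟩ := Finset.mem_image.1 hφ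
    exact ⟨φ'.take n, hlt φ' hφ', hh φ'⟩
  · intro σ hσ φ hφ ψ hψ hσφ hσψ
    obtain ⟨φ', hφ', rfl⟩ := Finset.mem_image.1 hφ
    obtain ⟨ψ', hψ', rfl⟩ := Finset.mem_image.1 hψ
    rw [htake φ' hφ' ψ' hψ' ((key σ hσ φ' hφ' hσφ).symm.trans (key σ hσ ψ' hψ' hσψ))]
  · intro ψ hψ
    obtain ⟨φ, hφ, rfl⟩ := Finset.mem_image.1 hψ
    by_cases hM : M ≤ φ.length
    · right
      simp only [h, if_pos hM]
      have := (prefix_peak p (φ.take N)).length_le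
      rwa [List.length_take, min_eq_left (hNM.trans hM)] at this
    · left
      simpa only [h, if_neg hM] using hφ
  · let D : Node → ℝ := fun σ => |(|p (peak p σ)| - |r (peak r σ)|)|
    have hinj' : Set.InjOn (fun φ : Node => φ.take N) (A.filter fun φ => M ≤ φ.length) := by
      intro φ hφ ψ hψ he
      refine htake φ (Finset.mem_filter.1 hφ).1 ψ (Finset.mem_filter.1 hψ).1 ?_
      have he' : φ.take N = ψ.take N := he
      rw [← min_eq_left hnN, ← List.take_take, he', List.take_take]
    have hD : ∑ φ ∈ A with M ≤ φ.length, D (φ.take N) ≤ ∑ σ ∈ levelNodes N, D σ := by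
      rw [← Finset.sum_image hinj']
      refine Finset.sum_le_sum_of_subset_of_nonneg ?_ fun _ _ _ => abs_nonneg _
      intro σ hσ
      obtain ⟨φ, hφ, rfl⟩ := Finset.mem_image.1 hσ
      rw [mem_levelNodes, List.length_take,
        min_eq_left (hNM.trans (Finset.mem_filter.1 hφ).2)]
    refine le_trans ?_ (add_le_add_right hD _)
    rw [Finset.sum_image hinj, Finset.sum_filter, Finset.sum_filter, ← Finset.sum_add_distrib,
      ← Finset.sum_add_distrib]
    refine Finset.sum_le_sum fun φ _ => ?_
    by_cases hM : M ≤ φ.length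
    · simp only [h, if_pos hM, hp φ hM, abs_zero, zero_add, D]
      have := abs_le_abs_peak r (List.take_prefix N φ)
      have h3 := neg_abs_le (|p (peak p (φ.take N))| - |r (peak r (φ.take N))|)
      linarith
    · simp [h, hM]

lemma normX_add_add_le {q p r : Node →₀ ℝ} {N M : ℕ} {κ : ℝ} (hκ : 0 < κ) (hκ1 : κ ≤ 1)
    (hNM : N ≤ M) (hq1 : normX q ≤ 1) (hp1 : normX p ≤ 1) (hr1 : normX r ≤ 1)
    (hq : ∀ φ : Node, N ≤ φ.length → q φ = 0) (hp : ∀ φ : Node, M ≤ φ.length → p φ = 0)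
    (htail : 2 * κ ≤ normX (p.filter fun φ => N ≤ φ.length) ^ 2)
    (hshort : ∑ φ ∈ shortNodes N, |p φ - r φ| ≤ κ / 12)
    (hmid : ∀ A : Finset Node, Admissible A →
      ∑ φ ∈ A with N ≤ φ.length ∧ φ.length < M, |r φ| ≤ κ / 12)
    (hpeak : ∑ σ ∈ levelNodes N, |(|p (peak p σ)| - |r (peak r σ)|)| ≤ κ / 12) :
    normX (q + p + r) ≤ 3 - 3 * (κ ^ 2 / 1152) := by
  classical
  have hκ2 : κ ^ 2 ≤ κ := by nlinarith
  refine normX_le_of_chains (by nlinarith) fun k A hA => ?_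
  by_contra! hlt
  have sum_nonneg' : ∀ (x : Node →₀ ℝ) (B : Finset Node), 0 ≤ ∑ φ ∈ B, |x φ| :=
    fun x B => Finset.sum_nonneg fun _ _ => abs_nonneg _
  have one_of : ∀ x : Node →₀ ℝ, normX x ≤ 1 → ∀ (k : ℕ) (B : Fin k → Finset Node),
      IsChainX B → ∑ i, (∑ φ ∈ B i, |x φ|) ^ 2 ≤ 1 := fun x hx k B hB =>
    (hB.sum_sq_le x).trans (pow_le_one₀ (normX_nonneg x) hx)
  obtain ⟨hab, hbc, hb⟩ := sum_sq_dist_and_lower Finset.univ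
    (fun i => ∑ φ ∈ A i, |q φ|) (fun i => ∑ φ ∈ A i, |p φ|) (fun i => ∑ φ ∈ A i, |r φ|)
    (fun i => ∑ φ ∈ A i, |(q + p + r) φ|) (δ := κ ^ 2 / 1152) (fun i => sum_nonneg' _ _)
    (fun i => by
      simp only [← Finset.sum_add_distrib]
      exact Finset.sum_le_sum fun φ _ => abs_add_three _ _ _)
    (one_of q hq1 k A hA) (one_of p hp1 k A hA) (one_of r hr1 k A hA) hlt.le
  set b : Fin k → ℝ := fun i => ∑ φ ∈ A i, |p φ|
  have hq0 : ∀ i, (∀ φ ∈ A i, N ≤ φ.length) → ∑ φ ∈ A i, |q φ| = 0 := fun i hi =>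
    Finset.sum_eq_zero fun φ hφ => by rw [hq φ (hi φ hφ), abs_zero]
  -- the last member of the chain that meets the first `N` levels
  obtain ⟨i₀, ⟨φ₀, hφ₀, hφ₀N⟩, hi₀⟩ : ∃ i₀, (∃ φ ∈ A i₀, φ.length < N) ∧
      ∀ i, i₀ < i → ∀ φ ∈ A i, N ≤ φ.length := by
    have hne : (Finset.univ.filter fun i => ∃ φ ∈ A i, φ.length < N).Nonempty := by
      by_contra hne
      rw [Finset.not_nonempty_iff_eq_empty, Finset.filter_eq_empty_iff] at hne
      have h3 : ∑ i, (∑ φ ∈ A i, |q φ| - b i) ^ 2 = ∑ i, b i ^ 2 := by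
        refine Finset.sum_congr rfl fun i _ => ?_
        have := hne (Finset.mem_univ i)
        push Not at this
        rw [hq0 i this]
        ring
      rw [h3] at hab
      nlinarith
    refine ⟨Finset.max' _ hne, (Finset.mem_filter.1 (Finset.max'_mem _ hne)).2, ?_⟩
    intro i hi φ hφ
    by_contra! hlt'
    exact absurd (Finset.le_max' _ i (Finset.mem_filter.2 ⟨Finset.mem_univ _, φ, hφ, hlt'⟩))
      (not_le.2 hi)
  have hlow : ∀ i, i < i₀ → ∀ φ ∈ A i, φ.length < N := fun i hi φ hφ =>
    (hA.2 i i₀ hi φ hφ φ₀ hφ₀).trans hφ₀N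
  have hsplit : ∀ f : Fin k → ℝ,
      ∑ i, f i = ∑ i with i < i₀, f i + f i₀ + ∑ i with i₀ < i, f i := by
    intro f
    rw [← Finset.sum_filter_add_sum_filter_not Finset.univ (fun i => i < i₀), add_assoc]
    congr 1
    have : (Finset.univ.filter fun i => ¬ i < i₀)
        = insert i₀ (Finset.univ.filter fun i => i₀ < i) := by
      ext i
      simp [le_iff_lt_or_eq, eq_comm, or_comm]
    rw [this, Finset.sum_insert (by simp)]
  set P := ∑ i with i < i₀, b i ^ 2
  have hhigh : ∑ i with i₀ < i, b i ^ 2 ≤ κ ^ 2 / 64 := by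
    calc ∑ i with i₀ < i, b i ^ 2 = ∑ i with i₀ < i, (∑ φ ∈ A i, |q φ| - b i) ^ 2 := by
          refine Finset.sum_congr rfl fun i hi => ?_
          rw [hq0 i (hi₀ i (Finset.mem_filter.1 hi).2)]
          ring
      _ ≤ ∑ i, (∑ φ ∈ A i, |q φ| - b i) ^ 2 :=
          Finset.sum_le_sum_of_subset_of_nonneg (Finset.filter_subset _ _)
            fun _ _ _ => sq_nonneg _
      _ ≤ κ ^ 2 / 64 := by linarith
  have hPb : 1 - κ ^ 2 / 48 ≤ P + b i₀ ^ 2 := by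
    rw [hsplit fun i => b i ^ 2] at hb
    linarith
  have hP0 : 0 ≤ P := Finset.sum_nonneg fun _ _ => sq_nonneg _
  set b₀ := ∑ φ ∈ A i₀ with φ.length < N, |p φ|
  have hb₀0 : 0 ≤ b₀ := sum_nonneg' _ _
  have hb₀b : b₀ ≤ b i₀ := Finset.sum_le_sum_of_subset_of_nonneg (Finset.filter_subset _ _)
    fun _ _ _ => abs_nonneg _
  -- the mass of `p` seen beyond level `N` is large
  have hPb₀ : P + b₀ ^ 2 + 2 * κ ≤ 1 := by
    have h3 := hA.sum_sq_add_normX_filter_sq_le p N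
    rw [hsplit] at h3
    have h4 : ∑ i with i < i₀, (∑ φ ∈ A i with φ.length < N, |p φ|) ^ 2 = P := by
      refine Finset.sum_congr rfl fun i hi => ?_
      rw [Finset.filter_true_of_mem (hlow i (Finset.mem_filter.1 hi).2)]
    have h5 : 0 ≤ ∑ i with i₀ < i, (∑ φ ∈ A i with φ.length < N, |p φ|) ^ 2 :=
      Finset.sum_nonneg fun _ _ => sq_nonneg _
    have h6 := pow_le_one₀ (n := 2) (normX_nonneg p) hp1
    linarith
  have hbi1 : b i₀ ≤ 1 := ((hA.1 i₀).sum_le p).trans hp1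
  have hb₁ : κ - κ ^ 2 / 96 ≤ b i₀ - b₀ := by nlinarith
  -- the mass of `r` seen beyond level `M` is large
  set c₂ := ∑ φ ∈ A i₀ with M ≤ φ.length, |r φ| with hc₂
  have hbc₀ : |b i₀ - ∑ φ ∈ A i₀, (|r φ|)| ≤ κ / 8 := by
    refine abs_le_of_sq_le_sq ?_ (by positivity)
    have := Finset.single_le_sum (f := fun i => (b i - ∑ φ ∈ A i, |r φ|) ^ 2)
      (fun _ _ => sq_nonneg _) (Finset.mem_univ i₀)
    nlinarith
  have hc : ∑ φ ∈ A i₀, |r φ| = ∑ φ ∈ A i₀ with φ.length < N, |r φ|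
      + ∑ φ ∈ A i₀ with N ≤ φ.length ∧ φ.length < M, |r φ| + c₂ := by
    simp only [hc₂, Finset.sum_filter, ← Finset.sum_add_distrib]
    refine Finset.sum_congr rfl fun φ _ => ?_
    rcases lt_or_ge φ.length N with h | h
    · simp [h, h.not_ge, (h.trans_le hNM).not_ge]
    · rcases lt_or_ge φ.length M with h' | h'
      · simp [h, h', h.not_gt, h'.not_ge]
      · simp [h, h', h.not_gt, h'.not_gt]
  have hc₀ : ∑ φ ∈ A i₀ with φ.length < N, |r φ| ≤ b₀ + κ / 12 := by
    have h3 : ∑ φ ∈ A i₀ with φ.length < N, |p φ - r φ| ≤ κ / 12 := by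
      refine le_trans (Finset.sum_le_sum_of_subset_of_nonneg ?_ fun _ _ _ => abs_nonneg _) hshort
      intro φ hφ
      exact mem_shortNodes.2 (Finset.mem_filter.1 hφ).2
    have h4 : ∑ φ ∈ A i₀ with φ.length < N, |r φ| ≤
        ∑ φ ∈ A i₀ with φ.length < N, (|p φ| + |p φ - r φ|) := by
      refine Finset.sum_le_sum fun φ _ => ?_
      have := abs_sub_abs_le_abs_sub (r φ) (p φ)
      rw [abs_sub_comm] at this
      linarith
    rw [Finset.sum_add_distrib] at h4
    linarith
  have hmid' := hmid (A i₀) (hA.1 i₀)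
  have hc₂' : κ / 2 ≤ c₂ - κ / 12 := by
    have := (abs_le.1 hbc₀).2
    linarith
  -- `p` sees both pieces on a modified chain
  obtain ⟨A', hA', hA'N, hsum⟩ := exists_admissible_transfer (hA.1 i₀) hNM ⟨φ₀, hφ₀, hφ₀N⟩ p r hp
  have hchain : IsChainX fun i => if i < i₀ then A i else if i = i₀ then A' else ∅ := by
    constructor
    · intro i
      simp only
      split_ifs
      exacts [hA.1 i, hA', admissible_empty]
    · intro i j hij φ hφ ψ hψ
      simp only at hφ hψ
      by_cases hj : j < i₀
      · rw [if_pos (hij.trans hj)] at hφ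
        rw [if_pos hj] at hψ
        exact hA.2 i j hij φ hφ ψ hψ
      · rw [if_neg hj] at hψ
        split_ifs at hψ with hj'
        · subst hj'
          rw [if_pos hij] at hφ
          rcases hA'N ψ hψ with h | h
          · exact hA.2 i j hij φ hφ ψ h
          · exact (hlow i hij φ hφ).trans_le h
        · simp at hψ
  have hfin := one_of p hp1 k _ hchain
  rw [hsplit] at hfin
  have h3 : ∑ i with i < i₀,
      (∑ φ ∈ if i < i₀ then A i else if i = i₀ then A' else ∅, |p φ|) ^ 2 = P := by
    refine Finset.sum_congr rfl fun i hi => ?_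
    rw [if_pos (Finset.mem_filter.1 hi).2]
  have h4 : 0 ≤ ∑ i with i₀ < i,
      (∑ φ ∈ if i < i₀ then A i else if i = i₀ then A' else ∅, |p φ|) ^ 2 :=
    Finset.sum_nonneg fun _ _ => sq_nonneg _
  rw [h3] at hfin
  simp only [lt_irrefl, if_false, if_true] at hfin
  have h5 : b i₀ + κ / 2 ≤ ∑ φ ∈ A', |p φ| := by
    have : b i₀ = ∑ φ ∈ A i₀, |p φ| := rfl
    linarith
  have h6 : (b i₀ + κ / 2) ^ 2 ≤ (∑ φ ∈ A', |p φ|) ^ 2 :=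
    pow_le_pow_left₀ (by linarith) h5 2
  nlinarith

lemma normX_add_le (x y : Node →₀ ℝ) : normX (x + y) ≤ normX x + normX y := by
  have hx0 := normX_nonneg x
  have hy0 := normX_nonneg y
  refine normX_le_of_chains (by positivity) fun k A hA => ?_
  have hx := hA.sum_sq_le x
  have hy := hA.sum_sq_le y
  set a : Fin k → ℝ := fun i => ∑ φ ∈ A i, |x φ|
  set b : Fin k → ℝ := fun i => ∑ φ ∈ A i, |y φ|
  have hcs : ∑ i, a i * b i ≤ normX x * normX y := by
    refine (abs_le_of_sq_le_sq' ?_ (by positivity)).2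
    refine (Finset.sum_mul_sq_le_sq_mul_sq _ a b).trans ?_
    rw [mul_pow]
    exact mul_le_mul hx hy (Finset.sum_nonneg fun _ _ => sq_nonneg _) (by positivity)
  calc ∑ i, (∑ φ ∈ A i, |(x + y) φ|) ^ 2 ≤ ∑ i, (a i + b i) ^ 2 := by
        refine Finset.sum_le_sum fun i _ => pow_le_pow_left₀
          (Finset.sum_nonneg fun _ _ => abs_nonneg _) ?_ 2
        simp only [a, b, ← Finset.sum_add_distrib]
        exact Finset.sum_le_sum fun φ _ => abs_add_le _ _
    _ = ∑ i, a i ^ 2 + 2 * ∑ i, a i * b i + ∑ i, b i ^ 2 := by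
        rw [Finset.mul_sum, ← Finset.sum_add_distrib, ← Finset.sum_add_distrib]
        exact Finset.sum_congr rfl fun i _ => by ring
    _ ≤ (normX x + normX y) ^ 2 := by nlinarith

lemma normX_neg (x : Node →₀ ℝ) : normX (-x) = normX x := by simp [normX]

lemma normX_sub_le (x y : Node →₀ ℝ) : normX (x - y) ≤ normX x + normX y := by
  rw [sub_eq_add_neg, ← normX_neg y]
  exact normX_add_le x (-y)

lemma normX_filter_lt_le (x : Node →₀ ℝ) (N : ℕ) :
    normX (x.filter fun φ => φ.length < N) ≤ normX x := by
  refine (abs_le_of_sq_le_sq' ?_ (normX_nonneg x)).2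
  nlinarith [normX_filter_sq_add_le x N, sq_nonneg (normX (x.filter fun φ => N ≤ φ.length))]

lemma exists_length_bound (x : Node →₀ ℝ) : ∃ N : ℕ, ∀ φ : Node, N ≤ φ.length → x φ = 0 := by
  refine ⟨x.support.sup List.length + 1, fun φ hφ => ?_⟩
  by_contra h
  have : φ.length ≤ x.support.sup List.length :=
    Finset.le_sup (f := List.length) (Finsupp.mem_support_iff.2 h)
  omega

/-- The restriction of a function on `T` to the levels below `N`. -/
noncomputable def truncate (v : Node → ℝ) (N : ℕ) : Node →₀ ℝ :=
  Finsupp.indicator (shortNodes N) fun φ _ => v φ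

lemma truncate_apply (v : Node → ℝ) (N : ℕ) (φ : Node) :
    truncate v N φ = if φ.length < N then v φ else 0 := by
  simp [truncate, Finsupp.indicator_apply]

lemma normX_le_sum_add (x : Node →₀ ℝ) (N : ℕ) :
    normX x ≤ ∑ φ ∈ shortNodes N, |x φ| + normX (x.filter fun φ => N ≤ φ.length) := by
  have hx : x = x.filter (fun φ => φ.length < N) + x.filter fun φ => N ≤ φ.length := by
    ext φ
    rw [Finsupp.add_apply, Finsupp.filter_apply, Finsupp.filter_apply]
    rcases lt_or_ge φ.length N with h | h
    · simp [h, h.not_ge]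
    · simp [h, h.not_gt]
  have h1 : normX (x.filter fun φ => φ.length < N) ≤ ∑ φ ∈ shortNodes N, |x φ| := by
    refine (normX_le_sum_of_support (s := shortNodes N) ?_).trans ?_
    · intro φ hφ
      rw [Finsupp.support_filter] at hφ
      exact mem_shortNodes.2 (Finset.mem_filter.1 hφ).2
    · rw [sum_abs_filter]
      exact Finset.sum_le_sum_of_subset_of_nonneg (Finset.filter_subset _ _)
        fun _ _ _ => abs_nonneg _
  have h2 := normX_add_le (x.filter fun φ => φ.length < N) (x.filter fun φ => N ≤ φ.length)
  rw [← hx] at h2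
  linarith

open Filter Topology in
lemma eventually_sum_abs_sub_le {ι : Type*} (s : Finset ι) {f : ℕ → ι → ℝ} {v : ι → ℝ}
    (h : ∀ i, Tendsto (fun n => f n i) atTop (𝓝 (v i))) {c : ℝ} (hc : 0 < c) :
    ∀ᶠ n in atTop, ∑ i ∈ s, |v i - f n i| ≤ c := by
  have h1 : Tendsto (fun n => ∑ i ∈ s, |v i - f n i|) atTop (𝓝 (∑ i ∈ s, |v i - v i|)) :=
    tendsto_finsetSum s fun i _ => (tendsto_const_nhds.sub (h i)).abs
  simp only [sub_self, abs_zero, Finset.sum_const_zero] at h1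
  filter_upwards [h1.eventually (gt_mem_nhds hc)] with n hn using hn.le

open Filter Topology in
lemma normX_truncate_le {p : ℕ → Node →₀ ℝ} {v : Node → ℝ} (hp : ∀ n, normX (p n) ≤ 1)
    (hv : ∀ φ, Tendsto (fun n => p n φ) atTop (𝓝 (v φ))) (N : ℕ) :
    normX (truncate v N) ≤ 1 := by
  refine le_of_forall_pos_le_add fun c hc => ?_
  obtain ⟨n, hn⟩ := (eventually_sum_abs_sub_le (shortNodes N) hv hc).exists
  have h1 := normX_add_le ((p n).filter fun φ => φ.length < N)
    (truncate v N - (p n).filter fun φ => φ.length < N)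
  rw [add_sub_cancel] at h1
  have h2 := (normX_filter_lt_le (p n) N).trans (hp n)
  have h3 : normX (truncate v N - (p n).filter fun φ => φ.length < N) ≤
      ∑ φ ∈ shortNodes N, |v φ - p n φ| := by
    refine (normX_le_sum_of_support (s := shortNodes N) ?_).trans (le_of_eq ?_)
    · intro φ hφ
      by_contra h
      rw [mem_shortNodes] at h
      simp [truncate_apply, h] at hφ
    · refine Finset.sum_congr rfl fun φ hφ => ?_
      rw [mem_shortNodes] at hφ
      simp [truncate_apply, hφ]
  linarith

lemma exists_normX_truncate_tail_le {v : Node → ℝ} (hv : ∀ N, normX (truncate v N) ≤ 1)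
    {c : ℝ} (hc : 0 < c) (N₀ : ℕ) :
    ∃ N, N₀ ≤ N ∧ ∀ M, N ≤ M → normX ((truncate v M).filter fun φ => N ≤ φ.length) ≤ c := by
  have hstep : ∀ N M, N ≤ M → normX (truncate v N) ^ 2 +
      normX ((truncate v M).filter fun φ => N ≤ φ.length) ^ 2 ≤ normX (truncate v M) ^ 2 := by
    intro N M hNM
    have h1 : (truncate v M).filter (fun φ => φ.length < N) = truncate v N := by
      ext φ
      rw [Finsupp.filter_apply, truncate_apply, truncate_apply]
      split_ifs with h h'
      exacts [rfl, absurd (h.trans_le hNM) h', rfl]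
    rw [← h1]
    exact normX_filter_sq_add_le _ N
  have hmono : Monotone fun N => normX (truncate v N) ^ 2 := fun N M hNM => by
    have := hstep N M hNM
    have := sq_nonneg (normX ((truncate v M).filter fun φ => N ≤ φ.length))
    simp only
    linarith
  have hbdd : BddAbove (Set.range fun N => normX (truncate v N) ^ 2) := by
    refine ⟨1, ?_⟩
    rintro _ ⟨N, rfl⟩
    exact pow_le_one₀ (normX_nonneg _) (hv N)
  obtain ⟨N₁, hN₁⟩ := exists_lt_of_lt_ciSup
    (sub_lt_self (⨆ N, normX (truncate v N) ^ 2) (pow_pos hc 2))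
  refine ⟨max N₀ N₁, le_max_left _ _, fun M hM => ?_⟩
  have h1 := hstep _ M hM
  have h2 := hmono (le_max_right N₀ N₁)
  have h3 := le_ciSup hbdd M
  simp only at h2 h3 hN₁
  refine (abs_le_of_sq_le_sq' ?_ hc.le).2
  linarith

open Filter Topology in
lemma exists_pair_normX_add_add_le {q : Node →₀ ℝ} {p : ℕ → Node →₀ ℝ} {v w : Node → ℝ}
    {s κ : ℝ} (hκ : 0 < κ) (hκ1 : κ ≤ 1) (hs : 0 < s) (hsκ : 2 * κ ≤ s ^ 2)
    (hq : normX q ≤ 1) (hp : ∀ n, normX (p n) ≤ 1)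
    (hsep : ∀ m n, m ≠ n → 2 * s + κ / 12 ≤ normX (p m - p n))
    (hv : ∀ φ, Tendsto (fun n => p n φ) atTop (𝓝 (v φ)))
    (hw : ∀ σ, Tendsto (fun n => |p n (peak (p n) σ)|) atTop (𝓝 (w σ))) :
    ∃ m n, m < n ∧ normX (q + p m + p n) ≤ 3 - 3 * (κ ^ 2 / 1152) := by
  have hc : 0 < κ / 24 := by positivity
  have hadd : ∀ {ι : Type} (t : Finset ι) (f g h : ι → ℝ), ∑ i ∈ t, |h i - f i| ≤ κ / 24 →
      ∑ i ∈ t, |h i - g i| ≤ κ / 24 → ∑ i ∈ t, |f i - g i| ≤ κ / 12 := by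
    intro ι t f g h h1 h2
    have h3 : ∑ i ∈ t, |f i - g i| ≤ ∑ i ∈ t, (|h i - f i| + |h i - g i|) :=
      Finset.sum_le_sum fun i _ => by
        rw [abs_sub_comm (h i) (f i)]
        exact abs_sub_le _ _ _
    rw [Finset.sum_add_distrib] at h3
    linarith
  obtain ⟨N₀, hN₀⟩ := exists_length_bound q
  obtain ⟨N, hNN₀, hN⟩ := exists_normX_truncate_tail_le (normX_truncate_le hp hv) hc N₀
  obtain ⟨K, hK⟩ := eventually_atTop.1 ((eventually_sum_abs_sub_le (shortNodes N) hv hc).and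
    (eventually_sum_abs_sub_le (levelNodes N) hw hc))
  obtain ⟨m, hmK, hm⟩ : ∃ m, K ≤ m ∧ s ≤ normX ((p m).filter fun φ => N ≤ φ.length) := by
    by_contra! hcon
    have h1 := hsep K (K + 1) (by simp)
    have h2 := normX_le_sum_add (p K - p (K + 1)) N
    have h3 := hadd _ _ _ _ (hK K le_rfl).1 (hK (K + 1) (by simp)).1
    rw [Finsupp.filter_sub] at h2
    have h4 := normX_sub_le ((p K).filter fun φ => N ≤ φ.length)
      ((p (K + 1)).filter fun φ => N ≤ φ.length)
    have h5 := hcon K le_rfl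
    have h6 := hcon (K + 1) (by simp)
    simp only [Finsupp.sub_apply] at h2
    linarith
  obtain ⟨M₀, hM₀⟩ := exists_length_bound (p m)
  obtain ⟨n, hn, hmn⟩ := ((eventually_sum_abs_sub_le (shortNodes (max N M₀)) hv hc).and
    (eventually_gt_atTop m)).exists
  refine ⟨m, n, hmn, normX_add_add_le hκ hκ1 (le_max_left N M₀) hq (hp m) (hp n)
    (fun φ hφ => hN₀ φ (hNN₀.trans hφ)) (fun φ hφ => hM₀ φ ((le_max_right _ _).trans hφ))
    (hsκ.trans (pow_le_pow_left₀ hs.le hm 2))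
    (hadd _ _ _ _ (hK m hmK).1 (hK n (hmK.trans hmn.le)).1) ?_
    (hadd _ _ _ _ (hK m hmK).2 (hK n (hmK.trans hmn.le)).2)⟩
  intro A hA
  set M := max N M₀
  have h1 := (hA.sum_le _).trans (hN M (le_max_left _ _))
  rw [sum_abs_filter] at h1
  have h2 : ∑ φ ∈ A with N ≤ φ.length ∧ φ.length < M, |v φ - p n φ| ≤ κ / 24 := by
    refine le_trans (Finset.sum_le_sum_of_subset_of_nonneg ?_ fun _ _ _ => abs_nonneg _) hn
    intro φ hφ
    exact mem_shortNodes.2 (Finset.mem_filter.1 hφ).2.2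
  have h3 : ∑ φ ∈ A with N ≤ φ.length ∧ φ.length < M, |v φ| ≤ κ / 24 := by
    refine le_trans (le_of_eq ?_) h1
    rw [Finset.sum_filter, Finset.sum_filter]
    refine Finset.sum_congr rfl fun φ _ => ?_
    rw [truncate_apply]
    split_ifs <;> simp_all
  have h4 : ∑ φ ∈ A with N ≤ φ.length ∧ φ.length < M, |p n φ| ≤
      ∑ φ ∈ A with N ≤ φ.length ∧ φ.length < M, (|v φ| + |v φ - p n φ|) := by
    refine Finset.sum_le_sum fun φ _ => ?_
    have := abs_sub_abs_le_abs_sub (p n φ) (v φ)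
    rw [abs_sub_comm] at this
    linarith
  rw [Finset.sum_add_distrib] at h4
  linarith

lemma exists_approx_in_ball {E X : Type*} [AddCommGroup E] [Module ℝ E]
    [NormedAddCommGroup X] [NormedSpace ℝ X] {j : E →ₗ[ℝ] X} (hj : DenseRange j) {η : ℝ}
    (hη : 0 < η) (hη1 : η ≤ 1) {z : X} (hz : ‖z‖ ≤ 1) :
    ∃ y : E, ‖j y‖ ≤ 1 ∧ ‖z - j y‖ ≤ 2 * η := by
  obtain ⟨y, hy⟩ := hj.exists_dist_lt ((1 - η) • z) hη
  rw [dist_eq_norm] at hy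
  have h1 : ‖(1 - η) • z‖ ≤ 1 - η := by
    rw [norm_smul, Real.norm_of_nonneg (by linarith)]
    nlinarith
  refine ⟨y, ?_, ?_⟩
  · have := norm_sub_norm_le (j y) ((1 - η) • z)
    rw [norm_sub_rev] at this
    linarith
  · have h2 : z - j y = η • z + ((1 - η) • z - j y) := by module
    have h3 : ‖η • z‖ ≤ η := by
      rw [norm_smul, Real.norm_of_nonneg hη.le]
      nlinarith
    rw [h2]
    linarith [norm_add_le (η • z) ((1 - η) • z - j y)]

/-- **Proposition 2.** Schachermayer's space `X` — the completion of `c₀₀(T)`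
under `‖·‖_X`, here represented by any Banach space `X` together with a dense
linear isometry `j` from `(c₀₀(T), ‖·‖_X)` — is `2`-β. -/
theorem schachermayer_X_two_beta
    (X : Type*) [NormedAddCommGroup X] [NormedSpace ℝ X] [CompleteSpace X]
    (j : (Node →₀ ℝ) →ₗ[ℝ] X) (hdense : DenseRange j)
    (hiso : ∀ y : Node →₀ ℝ, ‖j y‖ = normX y) :
    ∀ ε : ℝ, 0 < ε → ∃ δ : ℝ, 0 < δ ∧ δ < 1 ∧
      ∀ x : X, ‖x‖ ≤ 1 → ∀ u : ℕ → X, (∀ n, ‖u n‖ ≤ 1) → Separated ε u →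
        ∃ n₁ n₂ : ℕ, n₁ < n₂ ∧ ‖x + u n₁ + u n₂‖ / 3 ≤ 1 - δ := by
  intro ε hε
  obtain ⟨e, he0, he1, heε⟩ : ∃ e : ℝ, 0 < e ∧ e ≤ 1 ∧ e ≤ ε :=
    ⟨min ε 1, lt_min hε one_pos, min_le_right _ _, min_le_left _ _⟩
  obtain ⟨κ, hκe⟩ : ∃ κ : ℝ, κ = e ^ 2 / 18 := ⟨_, rfl⟩
  have hκ : 0 < κ := by rw [hκe]; positivity
  have hκ18 : κ ≤ e / 18 := by nlinarith
  have hκ1 : κ ≤ 1 := by linarith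
  obtain ⟨δ, hδκ⟩ : ∃ δ : ℝ, δ = κ ^ 2 / 1152 := ⟨_, rfl⟩
  have hδ : 0 < δ := by rw [hδκ]; positivity
  have hδκ' : δ ≤ κ := by nlinarith
  refine ⟨δ / 2, by linarith, by linarith, fun x hx u hu hsep => ?_⟩
  have happrox : ∀ z : X, ‖z‖ ≤ 1 → ∃ y : Node →₀ ℝ, normX y ≤ 1 ∧ ‖z - j y‖ ≤ δ / 4 := by
    intro z hz
    obtain ⟨y, hy1, hy⟩ := exists_approx_in_ball hdense (η := δ / 8) (by linarith) (by linarith) hz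
    exact ⟨y, hiso y ▸ hy1, by linarith⟩
  obtain ⟨q, hq1, hq⟩ := happrox x hx
  choose p hp1 hp using fun n => happrox (u n) (hu n)
  have hbound : ∀ n φ, |p n φ| ≤ 1 := fun n φ => (abs_apply_le_normX _ _).trans (hp1 n)
  obtain ⟨F, -, ψ, hψ, hF⟩ := (isCompact_univ_pi fun _ : Node =>
    (isCompact_Icc (a := ((-1 : ℝ), (-1 : ℝ))) (b := (1, 1)))).tendsto_subseq
    (x := fun n φ => (p n φ, |p n (peak (p n) φ)|)) (fun n φ _ => by
      have h1 := abs_le.1 (hbound n φ)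
      have h2 := hbound n (peak (p n) φ)
      have h3 := abs_nonneg (p n (peak (p n) φ))
      exact ⟨⟨h1.1, by simp only; linarith⟩, ⟨h1.2, h2⟩⟩)
  rw [tendsto_pi_nhds] at hF
  obtain ⟨m, n, hmn, hle⟩ := exists_pair_normX_add_add_le (q := q) (p := fun n => p (ψ n))
    (v := fun φ => (F φ).1) (w := fun φ => (F φ).2) (s := e / 3) hκ hκ1 (by positivity)
    (by rw [hκe]; linarith) hq1 (fun n => hp1 _)
    (fun m n hmn => by
      have h1 := hsep (ψ m) (ψ n) (hψ.injective.ne hmn)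
      rw [← hiso, map_sub]
      have h2 : u (ψ m) - u (ψ n) = (j (p (ψ m)) - j (p (ψ n))) +
          (u (ψ m) - j (p (ψ m))) - (u (ψ n) - j (p (ψ n))) := by abel
      rw [h2] at h1
      have h3 := norm_sub_le (j (p (ψ m)) - j (p (ψ n)) + (u (ψ m) - j (p (ψ m))))
        (u (ψ n) - j (p (ψ n)))
      have h4 := norm_add_le (j (p (ψ m)) - j (p (ψ n))) (u (ψ m) - j (p (ψ m)))
      have h5 := hp (ψ m)
      have h6 := hp (ψ n)
      linarith)
    (fun φ => (hF φ).fst_nhds) (fun φ => (hF φ).snd_nhds)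
  refine ⟨ψ m, ψ n, hψ hmn, ?_⟩
  rw [← hiso, map_add, map_add] at hle
  have h2 : x + u (ψ m) + u (ψ n) = (j q + j (p (ψ m)) + j (p (ψ n))) +
      ((x - j q) + (u (ψ m) - j (p (ψ m))) + (u (ψ n) - j (p (ψ n)))) := by abel
  have h3 := norm_add_le (j q + j (p (ψ m)) + j (p (ψ n)))
    ((x - j q) + (u (ψ m) - j (p (ψ m))) + (u (ψ n) - j (p (ψ n))))
  have h4 := norm_add₃_le (a := x - j q) (b := u (ψ m) - j (p (ψ m)))
    (c := u (ψ n) - j (p (ψ n)))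
  rw [← h2] at h3
  have h5 := hp (ψ m)
  have h6 := hp (ψ n)
  linarith
end

section
/- The Banach space Y (the completion of c₀₀(T) with respect to the norm ‖·‖_Y) is 2-NUC: for every ε > 0 there exists δ with 0 < δ < 1 such that for every ε-separated sequence (x_n) in the closed unit ball of Y there are indices n₁ < n₂ with ‖x_{n₁} + x_{n₂}‖_Y/2 ≤ 1 − δ. -/
open scoped BigOperators

/-! ### Finite `ℓ²` estimates -/

lemma sum_add_sq_le {ι : Type*} (s : Finset ι) {a b : ι → ℝ} {r t : ℝ} (hr : 0 ≤ r) (ht : 0 ≤ t)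
    (ha : ∑ i ∈ s, a i ^ 2 ≤ r ^ 2) (hb : ∑ i ∈ s, b i ^ 2 ≤ t ^ 2) :
    ∑ i ∈ s, (a i + b i) ^ 2 ≤ (r + t) ^ 2 := by
  have hcs := Finset.sum_mul_sq_le_sq_mul_sq s a b
  have hab : ∑ i ∈ s, a i * b i ≤ r * t := by
    refine le_of_sq_le_sq ?_ (mul_nonneg hr ht)
    calc _ ≤ _ := hcs
      _ ≤ r ^ 2 * t ^ 2 := by gcongr
      _ = _ := by ring
  have : ∑ i ∈ s, (a i + b i) ^ 2
      = ∑ i ∈ s, a i ^ 2 + 2 * ∑ i ∈ s, a i * b i + ∑ i ∈ s, b i ^ 2 := by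
    rw [Finset.mul_sum, ← Finset.sum_add_distrib, ← Finset.sum_add_distrib]
    exact Finset.sum_congr rfl fun i _ => by ring
  nlinarith

/-- If `a + b` and `a + c` nearly lie in the unit ball of `ℓ²`, their midpoint is nearly of norm
one, and `a` is not, then `b` and `c` nearly coincide; if moreover `b` and `c` overlap in at most
one coordinate, they are concentrated there. -/
lemma exists_concentration {k : ℕ} {a b c : ℕ → ℝ} {η κ ρ : ℝ}
    (hb : ∀ i, 0 ≤ b i) (hc : ∀ i, 0 ≤ c i)
    (hη : 40 * η = κ ^ 2) (hκ : 0 < κ) (hκρ : κ ≤ ρ ^ 2 / 16) (hρ : 0 < ρ) (hρ' : ρ ≤ 1 / 256)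
    (h_a : ∑ i ∈ Finset.range k, a i ^ 2 ≤ (1 - 4 * ρ) ^ 2)
    (hab : ∑ i ∈ Finset.range k, (a i + b i) ^ 2 ≤ (1 + 2 * η) ^ 2)
    (hac : ∑ i ∈ Finset.range k, (a i + c i) ^ 2 ≤ (1 + 2 * η) ^ 2)
    (habc : (2 - 6 * η) ^ 2 < ∑ i ∈ Finset.range k, (2 * a i + b i + c i) ^ 2)
    (hsep : ∀ i, 0 < b i → 0 < c i →
      (∀ j < i, c j = 0) ∧ ∀ j, i < j → a j = 0 ∧ b j = 0) :
    ∃ i < k, 0 < b i ∧ 2 * ρ ≤ c i ∧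
      (1 - 8 * η - κ) ^ 2 ≤ ∑ j ∈ Finset.range i, a j ^ 2 + (a i + b i) ^ 2 := by
  have hκ1 : κ ≤ 1 / 1000000 := by nlinarith
  have hηκ : η ≤ κ / 40 := by nlinarith
  have hη0 : 0 < η := by nlinarith
  have hκρ' : κ ≤ ρ / 16 := by nlinarith
  have hdiff : ∑ i ∈ Finset.range k, (b i - c i) ^ 2 ≤ κ ^ 2 := by
    have : ∑ i ∈ Finset.range k, (b i - c i) ^ 2
        = 2 * ∑ i ∈ Finset.range k, (a i + b i) ^ 2 + 2 * ∑ i ∈ Finset.range k, (a i + c i) ^ 2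
          - ∑ i ∈ Finset.range k, (2 * a i + b i + c i) ^ 2 := by
      rw [Finset.mul_sum, Finset.mul_sum, ← Finset.sum_add_distrib, ← Finset.sum_sub_distrib]
      exact Finset.sum_congr rfl fun i _ => by ring
    nlinarith
  have hab' : (1 - 8 * η) ^ 2 < ∑ i ∈ Finset.range k, (a i + b i) ^ 2 := by
    by_contra! h
    have := sum_add_sq_le (Finset.range k) (by linarith) (by linarith) h hac
    rw [show 1 - 8 * η + (1 + 2 * η) = 2 - 6 * η by ring] at this
    refine absurd habc (not_lt.2 (le_trans (le_of_eq ?_) this))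
    exact Finset.sum_congr rfl fun i _ => by ring
  obtain ⟨i, hik, hbi, hci⟩ : ∃ i < k, 0 < b i ∧ 0 < c i := by
    by_contra! h
    have hbk : ∑ i ∈ Finset.range k, b i ^ 2 ≤ κ ^ 2 := by
      refine le_trans (Finset.sum_le_sum fun i hi => ?_) hdiff
      rcases (hb i).eq_or_lt with h0 | h0
      · rw [← h0]; nlinarith [sq_nonneg (c i)]
      · have : c i = 0 := le_antisymm (h i (Finset.mem_range.1 hi) h0) (hc i)
        simp [this]
    have := sum_add_sq_le (Finset.range k) (by linarith) hκ.le h_a hbk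
    nlinarith
  obtain ⟨hlt, hgt⟩ := hsep i hbi hci
  have hi : i ∈ Finset.range k := Finset.mem_range.2 hik
  let e : ℕ → ℝ := fun j => if j = i then b i else 0
  have hbe : ∑ j ∈ Finset.range k, (b j - e j) ^ 2 ≤ κ ^ 2 := by
    refine le_trans (Finset.sum_le_sum fun j _ => ?_) hdiff
    rcases lt_trichotomy j i with h | h | h
    · simp [e, h.ne, hlt j h]
    · simp only [e, h, if_true, sub_self]; nlinarith [sq_nonneg (b i - c i)]
    · simp only [e, h.ne', if_false, (hgt j h).2]; nlinarith [sq_nonneg (c j)]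
  have hae : (1 - 8 * η - κ) ^ 2 < ∑ j ∈ Finset.range k, (a j + e j) ^ 2 := by
    by_contra! h
    have := sum_add_sq_le (Finset.range k) (by linarith) hκ.le h hbe
    rw [show 1 - 8 * η - κ + κ = 1 - 8 * η by ring] at this
    refine absurd hab' (not_lt.2 (le_trans (le_of_eq ?_) this))
    exact Finset.sum_congr rfl fun i _ => by ring
  have hbig : 3 * ρ ≤ b i := by
    have he : ∑ j ∈ Finset.range k, e j ^ 2 ≤ b i ^ 2 := by
      rw [Finset.sum_eq_single_of_mem i hi (by intro j _ hj; simp [e, hj])]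
      simp [e]
    have := hae.trans_le (sum_add_sq_le (Finset.range k) (by linarith) hbi.le h_a he)
    have := lt_of_pow_lt_pow_left₀ 2 (by linarith) this
    linarith
  have hbc : b i - c i ≤ κ := by
    refine le_of_sq_le_sq (le_trans ?_ hdiff) hκ.le
    exact Finset.single_le_sum (f := fun j => (b j - c j) ^ 2) (fun j _ => sq_nonneg _) hi
  refine ⟨i, hik, hbi, by linarith, hae.le.trans (le_of_eq ?_)⟩
  have hsub : Finset.range (i + 1) ⊆ Finset.range k := by
    intro j; simp only [Finset.mem_range]; omega
  rw [← Finset.sum_subset hsub, Finset.sum_range_succ]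
  · congr 1
    · exact Finset.sum_congr rfl fun j hj => by simp [e, (Finset.mem_range.1 hj).ne]
    · simp [e]
  · intro j _ hj
    have hij : i < j := by simpa using hj
    simp [e, hij.ne', (hgt j hij).1]

/-! ### Nodes followed by zeroes -/

/-- `ZeroFrom n φ` says that `φ` has length at least `n` and only zeroes after its first `n`
entries, that is, `φ ∈ S_σ` for the node `σ` made of these entries. -/
def ZeroFrom (n : ℕ) (φ : Node) : Prop :=
  n ≤ φ.length ∧ φ = φ.take n ++ List.replicate (φ.length - n) false

instance (n : ℕ) (φ : Node) : Decidable (ZeroFrom n φ) := inferInstanceAs (Decidable (_ ∧ _))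

lemma mem_Sset_iff {σ φ : Node} : φ ∈ Sset σ ↔ ZeroFrom σ.length φ ∧ φ.take σ.length = σ := by
  constructor
  · rintro ⟨k, rfl⟩
    simp [ZeroFrom]
  · rintro ⟨⟨_, h⟩, h'⟩
    exact ⟨_, h' ▸ h⟩

lemma zeroFrom_append (σ : Node) (k : ℕ) : ZeroFrom σ.length (σ ++ List.replicate k false) := by
  simp [ZeroFrom]

lemma acceptable_iff {A : Finset Node} : Acceptable A ↔
    ∃ n, (∀ φ ∈ A, ZeroFrom n φ) ∧ Set.InjOn (List.take n) (A : Set Node) := by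
  refine exists_congr fun n => ?_
  have hmem : ∀ φ : Node, ZeroFrom n φ → (φ.take n).length = n ∧ φ ∈ Sset (φ.take n) := by
    intro φ h
    have hl : (φ.take n).length = n := by simpa using h.1
    exact ⟨hl, mem_Sset_iff.2 (by rw [hl]; exact ⟨h, rfl⟩)⟩
  constructor
  · rintro ⟨h₁, h₂⟩
    have h₃ : ∀ φ ∈ A, ZeroFrom n φ := by
      intro φ hφ
      obtain ⟨σ, rfl, h⟩ := h₁ φ hφ
      exact (mem_Sset_iff.1 h).1
    refine ⟨h₃, fun φ hφ ψ hψ h => ?_⟩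
    have hψ' := (hmem ψ (h₃ ψ hψ)).2
    rw [← h] at hψ'
    obtain ⟨hl, hφ'⟩ := hmem φ (h₃ φ hφ)
    exact h₂ _ hl φ hφ ψ hψ hφ' hψ'
  · rintro ⟨h₁, h₂⟩
    refine ⟨fun φ hφ => ⟨_, hmem φ (h₁ φ hφ)⟩, ?_⟩
    rintro σ rfl φ hφ ψ hψ hσφ hσψ
    exact h₂ hφ hψ ((mem_Sset_iff.1 hσφ).2.trans (mem_Sset_iff.1 hσψ).2.symm)

lemma ZeroFrom.isPrefix {n : ℕ} {φ ψ : Node} (hφ : ZeroFrom n φ) (hψ : ZeroFrom n ψ)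
    (h : φ.take n = ψ.take n) (hl : φ.length ≤ ψ.length) : φ <+: ψ := by
  rw [hφ.2, hψ.2, h, List.prefix_append_right_inj]
  exact ⟨List.replicate (ψ.length - φ.length) false, by
    rw [List.replicate_append_replicate]; congr 1; have := hφ.1; omega⟩

lemma take_eq_of_isPrefix {φ ψ : Node} (h : φ <+: ψ) {n : ℕ} (hn : n ≤ φ.length) :
    φ.take n = ψ.take n := by
  obtain ⟨t, rfl⟩ := h
  rw [List.take_append_of_le_length hn]

lemma ZeroFrom.take_eq {n m : ℕ} {φ ψ : Node} (hφ : ZeroFrom n φ) (hψ : ZeroFrom n ψ)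
    (h : φ.take n = ψ.take n) (hmφ : m ≤ φ.length) (hmψ : m ≤ ψ.length) :
    φ.take m = ψ.take m := by
  rcases le_total φ.length ψ.length with hl | hl
  · exact take_eq_of_isPrefix (hφ.isPrefix hψ h hl) hmφ
  · exact (take_eq_of_isPrefix (hψ.isPrefix hφ h.symm hl) hmψ).symm

lemma zeroFrom_iff {n : ℕ} {φ : Node} :
    ZeroFrom n φ ↔ n ≤ φ.length ∧ ∀ b ∈ φ.drop n, b = false := by
  refine and_congr_right fun _ => ?_
  conv_lhs => lhs; rw [← List.take_append_drop n φ]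
  rw [List.append_cancel_left_eq, List.eq_replicate_iff]
  simp

lemma ZeroFrom.mono {n m : ℕ} {φ : Node} (h : ZeroFrom n φ) (hnm : n ≤ m) (hm : m ≤ φ.length) :
    ZeroFrom m φ := by
  rw [zeroFrom_iff] at h ⊢
  exact ⟨hm, fun b hb => h.2 b ((List.drop_suffix_drop_left φ hnm).subset hb)⟩

lemma ZeroFrom.of_isPrefix {n : ℕ} {φ ψ : Node} (h : ZeroFrom n ψ) (hφ : φ <+: ψ)
    (hn : n ≤ φ.length) : ZeroFrom n φ := by
  rw [zeroFrom_iff] at h ⊢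
  exact ⟨hn, fun b hb => h.2 b ((hφ.drop n).subset hb)⟩

lemma Acceptable.subset {A B : Finset Node} (hA : Acceptable A) (h : B ⊆ A) : Acceptable B := by
  obtain ⟨n, h₁, h₂⟩ := hA
  exact ⟨n, fun φ hφ => h₁ φ (h hφ), fun σ hσ φ hφ ψ hψ => h₂ σ hσ φ (h hφ) ψ (h hψ)⟩

lemma acceptable_empty : Acceptable ∅ := ⟨0, by simp, by simp⟩

/-- The finite set of nodes of length `n`. -/
noncomputable def level (n : ℕ) : Finset Node := (List.finite_length_eq Bool n).toFinset

lemma mem_level {n : ℕ} {φ : Node} : φ ∈ level n ↔ φ.length = n := by simp [level]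

/-- Choosing one node in each set `S_σ`, for `σ` in a set of nodes of the same length, yields an
acceptable set. -/
lemma acceptable_image {n : ℕ} {H : Finset Node} (hH : ∀ σ ∈ H, σ.length = n) (k : Node → ℕ) :
    Acceptable (H.image fun σ => σ ++ List.replicate (k σ) false) := by
  refine acceptable_iff.2 ⟨n, ?_, ?_⟩
  · intro φ hφ
    obtain ⟨σ, hσ, rfl⟩ := Finset.mem_image.1 hφ
    exact hH σ hσ ▸ zeroFrom_append σ _
  · intro φ hφ ψ hψ h
    obtain ⟨σ, hσ, rfl⟩ := Finset.mem_image.1 hφ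
    obtain ⟨τ, hτ, rfl⟩ := Finset.mem_image.1 hψ
    have hσ' := hH σ hσ
    have hτ' := hH τ hτ
    have : σ = τ := by simpa [List.take_append, hσ', hτ'] using h
    rw [this]

lemma injOn_append_zeroes {n : ℕ} (k : Node → ℕ) :
    Set.InjOn (fun σ : Node => σ ++ List.replicate (k σ) false) {σ | σ.length = n} := by
  intro σ hσ τ hτ h
  exact List.append_inj_left h (Eq.trans hσ (Eq.symm hτ))

/-! ### Sums along chains of acceptable sets -/

/-- An infinite sequence `A₀ ≪ A₁ ≪ ⋯` of acceptable sets (most of which may be empty). -/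
def AcceptableChain (A : ℕ → Finset Node) : Prop :=
  (∀ i, Acceptable (A i)) ∧ ∀ i j, i < j → Before (A i) (A j)

/-- The sum `∑_{i < k} (∑_{φ ∈ Aᵢ} |g φ|)²`. -/
noncomputable def chainSum (g : Node → ℝ) (A : ℕ → Finset Node) (k : ℕ) : ℝ :=
  ∑ i ∈ Finset.range k, (∑ φ ∈ A i, |g φ|) ^ 2

/-- `YBound g r` extends `‖g‖_Y ≤ r` to functions `g` on the tree of possibly infinite support. -/
def YBound (g : Node → ℝ) (r : ℝ) : Prop :=
  ∀ A, AcceptableChain A → ∀ k, chainSum g A k ≤ r ^ 2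

lemma AcceptableChain.subset {A B : ℕ → Finset Node} (hA : AcceptableChain A)
    (h : ∀ i, B i ⊆ A i) : AcceptableChain B :=
  ⟨fun i => (hA.1 i).subset (h i), fun i j hij φ hφ ψ hψ =>
    hA.2 i j hij φ (h i hφ) ψ (h j hψ)⟩

lemma chainSum_mono {g h : Node → ℝ} (hgh : ∀ φ, |g φ| ≤ |h φ|) (A : ℕ → Finset Node) (k : ℕ) :
    chainSum g A k ≤ chainSum h A k :=
  Finset.sum_le_sum fun _ _ => pow_le_pow_left₀ (Finset.sum_nonneg fun _ _ => abs_nonneg _)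
    (Finset.sum_le_sum fun φ _ => hgh φ) 2

lemma YBound.of_abs_le {g h : Node → ℝ} {r : ℝ} (hh : YBound h r) (hgh : ∀ φ, |g φ| ≤ |h φ|) :
    YBound g r :=
  fun A hA k => (chainSum_mono hgh A k).trans (hh A hA k)

lemma YBound.mono {g : Node → ℝ} {r s : ℝ} (hg : YBound g r) (hr : 0 ≤ r) (hrs : r ≤ s) :
    YBound g s :=
  fun A hA k => (hg A hA k).trans (by gcongr)

lemma YBound.add {g h : Node → ℝ} {r s : ℝ} (hr : 0 ≤ r) (hs : 0 ≤ s) (hg : YBound g r)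
    (hh : YBound h s) : YBound (g + h) (r + s) := by
  intro A hA k
  refine le_trans ?_ (sum_add_sq_le _ hr hs (hg A hA k) (hh A hA k))
  unfold chainSum
  gcongr with i
  rw [← Finset.sum_add_distrib]
  gcongr
  exact abs_add_le _ _

lemma YBound.neg {g : Node → ℝ} {r : ℝ} (hg : YBound g r) : YBound (-g) r :=
  hg.of_abs_le fun φ => by simp

lemma YBound.sub {g h : Node → ℝ} {r s : ℝ} (hr : 0 ≤ r) (hs : 0 ≤ s) (hg : YBound g r)
    (hh : YBound h s) : YBound (g - h) (r + s) :=
  sub_eq_add_neg g h ▸ hg.add hr hs hh.neg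

lemma YBound.sum_le {g : Node → ℝ} {r : ℝ} (hr : 0 ≤ r) (hg : YBound g r) {Q : Finset Node}
    (hQ : Acceptable Q) : ∑ φ ∈ Q, |g φ| ≤ r := by
  have h := hg (fun i => if i = 0 then Q else ∅)
    ⟨fun i => by dsimp only; split_ifs; exacts [hQ, acceptable_empty], fun i j hij => by
      simp [Before, (Nat.zero_le i).trans_lt hij |>.ne']⟩ 1
  exact le_of_sq_le_sq (by simpa [chainSum] using h) hr

lemma AcceptableChain.pairwise_disjoint {A : ℕ → Finset Node} (hA : AcceptableChain A) :
    Pairwise (Function.onFun Disjoint A) := by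
  have h : ∀ i j, i < j → Disjoint (A i) (A j) := fun i j hij =>
    Finset.disjoint_left.2 fun φ hi hj => lt_irrefl _ (hA.2 i j hij φ hi φ hj)
  intro i j hij
  rcases lt_or_gt_of_ne hij with h' | h'
  exacts [h i j h', (h j i h').symm]

/-- The norm of `Y` is dominated by the norm of `ℓ¹`. -/
lemma yBound_of_support {g : Node → ℝ} {F : Finset Node} (hF : ∀ φ, φ ∉ F → g φ = 0) :
    YBound g (∑ φ ∈ F, |g φ|) := by
  intro A hA k
  calc chainSum g A k ≤ (∑ i ∈ Finset.range k, ∑ φ ∈ A i, |g φ|) ^ 2 :=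
        Finset.sum_sq_le_sq_sum_of_nonneg fun i _ => Finset.sum_nonneg fun _ _ => abs_nonneg _
    _ ≤ _ := by
      gcongr
      rw [← Finset.sum_biUnion fun i _ j _ hij => hA.pairwise_disjoint hij,
        ← Finset.sum_filter_of_ne (p := (· ∈ F)) fun φ _ h => by
          by_contra h'; simp [hF φ h'] at h]
      exact Finset.sum_le_sum_of_subset_of_nonneg (fun φ h => (Finset.mem_filter.1 h).2)
        fun _ _ _ => abs_nonneg _

/-- Consecutive chains can be concatenated. -/
lemma exists_chain_append (g : Node → ℝ) (N : ℕ) {A B : ℕ → Finset Node}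
    (hA : AcceptableChain A) (hB : AcceptableChain B) (k l : ℕ) :
    ∃ C, AcceptableChain C ∧ ∃ m,
      chainSum (fun φ => if φ.length ≤ N then g φ else 0) A k +
        chainSum (fun φ => if φ.length ≤ N then 0 else g φ) B l = chainSum g C m := by
  refine ⟨fun i => if i < k then (A i).filter (·.length ≤ N)
    else (B (i - k)).filter (¬ ·.length ≤ N), ⟨fun i => ?_, fun i j hij φ hφ ψ hψ => ?_⟩, k + l, ?_⟩
  · dsimp only
    split_ifs
    exacts [(hA.1 _).subset (Finset.filter_subset _ _), (hB.1 _).subset (Finset.filter_subset _ _)]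
  · dsimp only at hφ hψ
    split_ifs at hφ hψ with h₁ h₂ h₂ <;> rw [Finset.mem_filter] at hφ hψ
    · exact hA.2 i j hij φ hφ.1 ψ hψ.1
    · omega
    · omega
    · exact hB.2 (i - k) (j - k) (by omega) φ hφ.1 ψ hψ.1
  · unfold chainSum
    rw [Finset.sum_range_add]
    congr 1
    · refine Finset.sum_congr rfl fun i hi => ?_
      dsimp only
      rw [if_pos (Finset.mem_range.1 hi), Finset.sum_filter]
      congr 1
      exact Finset.sum_congr rfl fun φ _ => by split_ifs <;> simp
    · refine Finset.sum_congr rfl fun i _ => ?_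
      dsimp only
      rw [if_neg (by lia), Nat.add_sub_cancel_left, Finset.sum_filter]
      congr 1
      exact Finset.sum_congr rfl fun φ _ => by split_ifs <;> simp

/-! ### The norm of `Y` -/

lemma exists_chain_of_fin (x : Node →₀ ℝ) {k : ℕ} {A : Fin k → Finset Node}
    (hA : ∀ i, Acceptable (A i)) (hA' : ∀ i j : Fin k, i < j → Before (A i) (A j)) :
    ∃ B, AcceptableChain B ∧ ∑ i, (∑ φ ∈ A i, |x φ|) ^ 2 = chainSum x B k := by
  refine ⟨fun i => if h : i < k then A ⟨i, h⟩ else ∅, ⟨fun i => ?_, fun i j hij => ?_⟩, ?_⟩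
  · dsimp only
    split_ifs
    exacts [hA _, acceptable_empty]
  · dsimp only
    split_ifs
    · exact hA' _ _ hij
    all_goals simp [Before]
  · rw [chainSum, ← Fin.sum_univ_eq_sum_range
      (fun i => (∑ φ ∈ if h : i < k then A ⟨i, h⟩ else ∅, |x φ|) ^ 2) k]
    simp

lemma normY_le_iff {x : Node →₀ ℝ} {r : ℝ} (hr : 0 ≤ r) : normY x ≤ r ↔ YBound x r := by
  constructor
  · intro h A hA k
    refine (Real.sqrt_le_left hr).1 (le_trans (le_csSup ?_ ?_) h)
    · refine ⟨∑ φ ∈ x.support, |x φ|, ?_⟩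
      rintro _ ⟨k, A, hA, hA', rfl⟩
      obtain ⟨B, hB, h⟩ := exists_chain_of_fin x hA hA'
      rw [h]
      exact (Real.sqrt_le_left (Finset.sum_nonneg fun _ _ => abs_nonneg _)).2
        (yBound_of_support (by simp) B hB k)
    · refine ⟨k, fun i => A i, fun i => hA.1 i, fun i j hij => hA.2 i j hij, ?_⟩
      rw [chainSum, Fin.sum_univ_eq_sum_range (fun i => (∑ φ ∈ A i, |x φ|) ^ 2)]
  · intro h
    refine Real.sSup_le ?_ hr
    rintro _ ⟨k, A, hA, hA', rfl⟩
    obtain ⟨B, hB, h'⟩ := exists_chain_of_fin x hA hA'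
    rw [h']
    exact (Real.sqrt_le_left hr).2 (h B hB k)

/-! ### Suprema along zero branches -/

/-- The supremum of `|z|` over `S_σ`. -/
noncomputable def branchSup (z : Node →₀ ℝ) (σ : Node) : ℝ :=
  ⨆ k : ℕ, |z (σ ++ List.replicate k false)|

lemma finite_range_branch (z : Node →₀ ℝ) (σ : Node) :
    (Set.range fun k : ℕ => |z (σ ++ List.replicate k false)|).Finite :=
  (z.finite_range.image abs).subset <| by
    rintro _ ⟨k, rfl⟩
    exact ⟨_, ⟨_, rfl⟩, rfl⟩

lemma le_branchSup (z : Node →₀ ℝ) (σ : Node) (k : ℕ) :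
    |z (σ ++ List.replicate k false)| ≤ branchSup z σ :=
  le_ciSup (finite_range_branch z σ).bddAbove k

lemma exists_eq_branchSup (z : Node →₀ ℝ) (σ : Node) :
    ∃ k : ℕ, |z (σ ++ List.replicate k false)| = branchSup z σ :=
  (Set.range_nonempty _).csSup_mem (finite_range_branch z σ)

lemma branchSup_nonneg (z : Node →₀ ℝ) (σ : Node) : 0 ≤ branchSup z σ :=
  (abs_nonneg _).trans (le_branchSup z σ 0)

lemma ZeroFrom.le_branchSup {n : ℕ} {φ : Node} (h : ZeroFrom n φ) (z : Node →₀ ℝ) :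
    |z φ| ≤ branchSup z (φ.take n) := by
  conv_lhs => rw [h.2]
  exact _root_.le_branchSup z _ _

lemma branchSup_le_append {z : Node →₀ ℝ} {n M : ℕ} (hz : ∀ φ : Node, φ.length ≤ M → z φ = 0)
    (σ : Node) (hσ : σ.length + n ≤ M) :
    branchSup z σ ≤ branchSup z (σ ++ List.replicate n false) := by
  obtain ⟨k, hk⟩ := exists_eq_branchSup z σ
  rw [← hk]
  by_cases h : σ.length + k ≤ M
  · rw [hz _ (by simpa using h), abs_zero]
    exact branchSup_nonneg _ _
  · refine le_trans (le_of_eq ?_) (le_branchSup z _ (k - n))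
    rw [List.append_assoc, List.replicate_append_replicate, Nat.add_sub_cancel' (by omega)]

lemma YBound.sum_branchSup_le {z : Node →₀ ℝ} {r : ℝ} (hr : 0 ≤ r) (hz : YBound z r) (n : ℕ) :
    ∑ σ ∈ level n, branchSup z σ ≤ r := by
  choose k hk using exists_eq_branchSup z
  have hl : ∀ σ ∈ level n, σ.length = n := fun σ => mem_level.1
  have := hz.sum_le hr (acceptable_image hl k)
  rwa [Finset.sum_image fun σ hσ τ hτ => injOn_append_zeroes k (hl σ hσ) (hl τ hτ),
    Finset.sum_congr rfl fun σ _ => hk σ] at this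

/-- The nodes of an acceptable set of level `ℓ > ℓ₀` that do not lie on zero branches of level
`ℓ₀` carry little mass of `w`, if the sums of `branchSup w` over both levels nearly agree. -/
lemma sum_not_zeroFrom_le {w : Node →₀ ℝ} {C : Finset Node} {ℓ ℓ₀ M : ℕ} {θ : ℝ} (hθ : 0 ≤ θ)
    (hC : ∀ φ ∈ C, ZeroFrom ℓ φ) (hC' : Set.InjOn (List.take ℓ) (C : Set Node))
    (hCM : ∀ φ ∈ C, M < φ.length) (hℓ : ℓ ≤ M) (hℓ₀ : ℓ₀ ≤ M)
    (hw : ∀ φ : Node, φ.length ≤ M → w φ = 0)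
    (hlevel : ∑ σ ∈ level ℓ, branchSup w σ ≤ ∑ σ ∈ level ℓ₀, branchSup w σ + θ) :
    ∑ φ ∈ C with ¬ ZeroFrom ℓ₀ φ, |w φ| ≤ θ := by
  rcases le_or_gt ℓ ℓ₀ with h | h
  · rw [Finset.filter_false_of_mem, Finset.sum_empty]
    · exact hθ
    · exact fun φ hφ => not_not.2 ((hC φ hφ).mono h (hℓ₀.trans (hCM φ hφ).le))
  let D := C.filter (¬ ZeroFrom ℓ₀ ·)
  have hD : ∀ φ ∈ D, φ ∈ C ∧ ¬ ZeroFrom ℓ₀ φ := fun φ hφ => Finset.mem_filter.1 hφ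
  let e : Node → Node := fun σ => σ ++ List.replicate (ℓ - ℓ₀) false
  have hl : ∀ σ ∈ level ℓ₀, σ.length = ℓ₀ := fun σ => mem_level.1
  have hdisj : Disjoint (D.image (List.take ℓ)) ((level ℓ₀).image e) := by
    refine Finset.disjoint_left.2 fun τ hτ hτ' => ?_
    obtain ⟨φ, hφ, rfl⟩ := Finset.mem_image.1 hτ
    obtain ⟨σ, hσ, hσφ⟩ := Finset.mem_image.1 hτ'
    refine (hD φ hφ).2 ?_
    rw [(hC φ (hD φ hφ).1).2, ← hσφ, ← hl σ hσ]
    simp only [e, List.append_assoc, List.replicate_append_replicate]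
    exact zeroFrom_append _ _
  have hsub : D.image (List.take ℓ) ∪ (level ℓ₀).image e ⊆ level ℓ := by
    refine Finset.union_subset (fun τ hτ => ?_) (fun τ hτ => ?_)
    · obtain ⟨φ, hφ, rfl⟩ := Finset.mem_image.1 hτ
      exact mem_level.2 (by simpa using (hC φ (hD φ hφ).1).1)
    · obtain ⟨σ, hσ, rfl⟩ := Finset.mem_image.1 hτ
      exact mem_level.2 (by simp [e, hl σ hσ]; omega)
  have hsum := Finset.sum_le_sum_of_subset_of_nonneg hsub
    fun σ _ _ => branchSup_nonneg w σ
  rw [Finset.sum_union hdisj, Finset.sum_image fun φ hφ ψ hψ => hC' (hD φ hφ).1 (hD ψ hψ).1,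
    Finset.sum_image fun σ hσ τ hτ => injOn_append_zeroes (fun _ => ℓ - ℓ₀) (hl σ hσ) (hl τ hτ)] at hsum
  have h₁ : ∑ φ ∈ D, |w φ| ≤ ∑ φ ∈ D, branchSup w (φ.take ℓ) :=
    Finset.sum_le_sum fun φ hφ => (hC φ (hD φ hφ).1).le_branchSup w
  have h₂ : ∑ σ ∈ level ℓ₀, branchSup w σ ≤ ∑ σ ∈ level ℓ₀, branchSup w (e σ) :=
    Finset.sum_le_sum fun σ hσ => branchSup_le_append hw σ (by rw [hl σ hσ]; omega)
  change ∑ φ ∈ D, |w φ| ≤ θ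
  linarith

/-- If the suprema of `z` and `w` along zero branches nearly agree and `z` is supported before
`w`, then the part of an acceptable set carrying mass of `w` can be traded for two acceptable
pieces, lying before and after its level, carrying about the same mass of `z`. -/
lemma exists_transfer {z w : Node →₀ ℝ} {A : Finset Node} {ℓ ℓ₀ M : ℕ} {θ₁ θ₂ : ℝ} (hθ : 0 ≤ θ₂)
    (hA : ∀ φ ∈ A, ZeroFrom ℓ φ) (hA' : Set.InjOn (List.take ℓ) (A : Set Node))
    (hℓ : ℓ ≤ M) (hℓ₀ : ℓ₀ ≤ M)
    (hz : ∀ φ : Node, M < φ.length → z φ = 0) (hw : ∀ φ : Node, φ.length ≤ M → w φ = 0)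
    (hzw : ∑ σ ∈ level ℓ₀, |branchSup w σ - branchSup z σ| ≤ θ₁)
    (hlevel : ∑ σ ∈ level ℓ, branchSup w σ ≤ ∑ σ ∈ level ℓ₀, branchSup w σ + θ₂) :
    ∃ Q R : Finset Node, Acceptable Q ∧ Acceptable (A.filter (·.length ≤ M) ∪ R) ∧
      Disjoint (A.filter (·.length ≤ M)) R ∧ (∀ φ ∈ Q, z φ ≠ 0 ∧ φ.length < ℓ) ∧
      (∀ φ ∈ R, z φ ≠ 0 ∧ ℓ ≤ φ.length) ∧
      ∑ φ ∈ A, |w φ| ≤ ∑ φ ∈ Q, |z φ| + ∑ φ ∈ R, |z φ| + (θ₁ + θ₂) := by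
  let C := A.filter (M < ·.length)
  have hC : ∀ φ ∈ C, φ ∈ A ∧ M < φ.length := fun φ hφ => Finset.mem_filter.1 hφ
  let C₀ := C.filter (ZeroFrom ℓ₀)
  have hC₀ : ∀ φ ∈ C₀, φ ∈ C ∧ ZeroFrom ℓ₀ φ := fun φ hφ => Finset.mem_filter.1 hφ
  have hinj : Set.InjOn (List.take ℓ₀) (C₀ : Set Node) := fun φ hφ ψ hψ h => by
    have hφ' := hC φ (hC₀ φ hφ).1
    have hψ' := hC ψ (hC₀ ψ hψ).1
    exact hA' hφ'.1 hψ'.1 ((hC₀ φ hφ).2.take_eq (hC₀ ψ hψ).2 h (hA φ hφ'.1).1 (hA ψ hψ'.1).1)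
  let H := C₀.image (List.take ℓ₀)
  have hH : ∀ σ ∈ H, σ.length = ℓ₀ := fun σ hσ => by
    obtain ⟨φ, hφ, rfl⟩ := Finset.mem_image.1 hσ
    simpa using (hC₀ φ hφ).2.1
  choose k hk using exists_eq_branchSup z
  let q : Node → Node := fun σ => σ ++ List.replicate (k σ) false
  let P := (H.image q).filter (z · ≠ 0)
  -- every node of `P` precedes a node of `C` on the same zero branch
  have hP : ∀ φ ∈ P, z φ ≠ 0 ∧ ∃ ψ ∈ C, φ = q (ψ.take ℓ₀) ∧ φ <+: ψ := by
    intro φ hφ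
    obtain ⟨hφ, hφz⟩ := Finset.mem_filter.1 hφ
    obtain ⟨σ, hσ, rfl⟩ := Finset.mem_image.1 hφ
    obtain ⟨ψ, hψ, rfl⟩ := Finset.mem_image.1 hσ
    refine ⟨hφz, ψ, (hC₀ ψ hψ).1, rfl, ?_⟩
    have hqψ : ZeroFrom ℓ₀ (q (ψ.take ℓ₀)) := by
      have := zeroFrom_append (ψ.take ℓ₀) (k (ψ.take ℓ₀))
      rwa [hH _ hσ] at this
    refine hqψ.isPrefix (hC₀ ψ hψ).2 ?_ ?_
    · exact List.take_left' (hH _ hσ)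
    · by_contra h
      exact hφz (hz _ ((hC ψ (hC₀ ψ hψ).1).2.trans (not_le.1 h)))
  have hAM : ∀ φ ∈ A.filter (·.length ≤ M), φ ∈ A ∧ φ.length ≤ M :=
    fun φ hφ => Finset.mem_filter.1 hφ
  have hne : ∀ φ ∈ A.filter (·.length ≤ M), ∀ ψ ∈ P, ℓ ≤ ψ.length → φ.take ℓ ≠ ψ.take ℓ := by
    intro φ hφ ψ hψ hl h
    obtain ⟨-, χ, hχ, -, hψχ⟩ := hP ψ hψ
    rw [take_eq_of_isPrefix hψχ hl] at h
    have := hA' (hAM φ hφ).1 (hC χ hχ).1 h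
    exact (hC χ hχ).2.not_ge (this ▸ (hAM φ hφ).2)
  have hR : ∀ φ ∈ P.filter (ℓ ≤ ·.length), φ ∈ P ∧ ℓ ≤ φ.length :=
    fun φ hφ => Finset.mem_filter.1 hφ
  refine ⟨P.filter (·.length < ℓ), P.filter (ℓ ≤ ·.length), ?_, ?_, ?_, ?_, ?_, ?_⟩
  · exact (acceptable_image hH k).subset
      ((Finset.filter_subset _ _).trans (Finset.filter_subset _ _))
  · refine acceptable_iff.2 ⟨ℓ, fun φ hφ => ?_, fun φ hφ ψ hψ h => ?_⟩
    · rcases Finset.mem_union.1 hφ with hφ | hφ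
      · exact hA φ (hAM φ hφ).1
      · obtain ⟨-, χ, hχ, -, h⟩ := hP φ (hR φ hφ).1
        exact (hA χ (hC χ hχ).1).of_isPrefix h (hR φ hφ).2
    · rcases Finset.mem_union.1 hφ with hφ | hφ <;> rcases Finset.mem_union.1 hψ with hψ | hψ
      · exact hA' (hAM φ hφ).1 (hAM ψ hψ).1 h
      · exact absurd h (hne φ hφ ψ (hR ψ hψ).1 (hR ψ hψ).2)
      · exact absurd h.symm (hne ψ hψ φ (hR φ hφ).1 (hR φ hφ).2)
      · obtain ⟨-, χ, hχ, rfl, hφχ⟩ := hP φ (hR φ hφ).1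
        obtain ⟨-, χ', hχ', rfl, hψχ'⟩ := hP ψ (hR ψ hψ).1
        rw [take_eq_of_isPrefix hφχ (hR _ hφ).2, take_eq_of_isPrefix hψχ' (hR _ hψ).2] at h
        rw [hA' (hC χ hχ).1 (hC χ' hχ').1 h]
  · exact Finset.disjoint_left.2 fun φ hφ hφ' =>
      hne φ hφ φ (hR φ hφ').1 (hR φ hφ').2 rfl
  · exact fun φ hφ => ⟨(hP φ (Finset.mem_filter.1 hφ).1).1, (Finset.mem_filter.1 hφ).2⟩
  · exact fun φ hφ => ⟨(hP φ (hR φ hφ).1).1, (hR φ hφ).2⟩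
  · have hPsum : ∑ φ ∈ P, |z φ| = ∑ σ ∈ H, branchSup z σ := by
      rw [Finset.sum_filter_of_ne fun φ _ h => by simpa using h,
        Finset.sum_image fun σ hσ τ hτ => injOn_append_zeroes k (hH σ hσ) (hH τ hτ)]
      exact Finset.sum_congr rfl fun σ _ => hk σ
    have hsplit : ∑ φ ∈ P.filter (·.length < ℓ), |z φ| + ∑ φ ∈ P.filter (ℓ ≤ ·.length), |z φ|
        = ∑ φ ∈ P, |z φ| := by
      simp only [← not_lt]
      exact Finset.sum_filter_add_sum_filter_not _ _ _
    have hAC : ∑ φ ∈ A, |w φ| = ∑ φ ∈ C, |w φ| := by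
      refine (Finset.sum_filter_of_ne fun φ _ h => ?_).symm
      by_contra h'
      exact h (by rw [hw φ (not_lt.1 h'), abs_zero])
    have hCsplit : ∑ φ ∈ C, |w φ| = ∑ φ ∈ C₀, |w φ| + ∑ φ ∈ C with ¬ ZeroFrom ℓ₀ φ, |w φ| :=
      (Finset.sum_filter_add_sum_filter_not _ _ _).symm
    have hloss := sum_not_zeroFrom_le hθ (fun φ hφ => hA φ (hC φ hφ).1)
      (hA'.mono fun φ hφ => (hC φ hφ).1) (fun φ hφ => (hC φ hφ).2) hℓ hℓ₀ hw hlevel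
    have hC₀sum : ∑ φ ∈ C₀, |w φ| ≤ ∑ σ ∈ H, branchSup w σ := by
      rw [Finset.sum_image hinj]
      exact Finset.sum_le_sum fun φ hφ => (hC₀ φ hφ).2.le_branchSup w
    have hHsum : ∑ σ ∈ H, branchSup w σ ≤ ∑ σ ∈ H, branchSup z σ + θ₁ := by
      rw [← sub_le_iff_le_add', ← Finset.sum_sub_distrib]
      refine le_trans (Finset.sum_le_sum fun σ _ => le_abs_self _) (le_trans ?_ hzw)
      exact Finset.sum_le_sum_of_subset_of_nonneg (fun σ hσ => mem_level.2 (hH σ hσ))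
        fun _ _ _ => abs_nonneg _
    linarith

/-! ### The midpoint estimate -/

/-- In a chain, the sets before `A i` can be cut at length `N`, and `A i` replaced by two sets. -/
lemma exists_chain_insert {A : ℕ → Finset Node} (hA : AcceptableChain A) {i N ℓ : ℕ}
    {Q R : Finset Node} (hQ : Acceptable Q) (hR : Acceptable R)
    (hQ' : ∀ φ ∈ Q, N < φ.length ∧ φ.length < ℓ)
    (hR' : ∀ φ ∈ R, ℓ ≤ φ.length ∧ (φ ∈ A i ∨ N < φ.length)) :
    ∃ B, AcceptableChain B ∧ ∀ g : Node → ℝ, chainSum g B (i + 2) =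
      ∑ j ∈ Finset.range i, (∑ φ ∈ A j with φ.length ≤ N, |g φ|) ^ 2 +
        (∑ φ ∈ Q, |g φ|) ^ 2 + (∑ φ ∈ R, |g φ|) ^ 2 := by
  let B : ℕ → Finset Node := fun j => if j < i then (A j).filter (·.length ≤ N) else
    if j = i then Q else if j = i + 1 then R else ∅
  have hBlt : ∀ j < i, B j = (A j).filter (·.length ≤ N) := fun j hj => by simp [B, hj]
  have hBi : B i = Q := by simp [B]
  have hBi' : B (i + 1) = R := by simp [B]
  have hBgt : ∀ j, i + 1 < j → B j = ∅ := fun j hj => by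
    simp [B, show ¬ j < i by omega, show j ≠ i by omega, show j ≠ i + 1 by omega]
  have hBcases : ∀ j, j < i ∨ j = i ∨ j = i + 1 ∨ i + 1 < j := fun j => by omega
  refine ⟨B, ⟨fun j => ?_, fun j j' hjj' φ hφ ψ hψ => ?_⟩, fun g => ?_⟩
  · rcases hBcases j with h | rfl | rfl | h
    · rw [hBlt j h]; exact (hA.1 j).subset (Finset.filter_subset _ _)
    · rwa [hBi]
    · rwa [hBi']
    · rw [hBgt j h]; exact acceptable_empty
  · rcases hBcases j with h | rfl | rfl | h
    · rw [hBlt j h, Finset.mem_filter] at hφ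
      rcases hBcases j' with h' | rfl | rfl | h'
      · rw [hBlt j' h', Finset.mem_filter] at hψ
        exact hA.2 j j' hjj' φ hφ.1 ψ hψ.1
      · rw [hBi] at hψ
        exact hφ.2.trans_lt (hQ' ψ hψ).1
      · rw [hBi'] at hψ
        rcases (hR' ψ hψ).2 with hψ | hψ
        · exact hA.2 j i h φ hφ.1 ψ hψ
        · exact hφ.2.trans_lt hψ
      · simp [hBgt j' h'] at hψ
    · rw [hBi] at hφ
      rcases hBcases j' with h' | rfl | rfl | h'
      · omega
      · omega
      · rw [hBi'] at hψ
        exact (hQ' φ hφ).2.trans_le (hR' ψ hψ).1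
      · simp [hBgt j' h'] at hψ
    · rw [hBgt j' hjj'] at hψ
      simp at hψ
    · simp [hBgt j h] at hφ
  · rw [chainSum, Finset.sum_range_succ, Finset.sum_range_succ, hBi, hBi']
    congr 2
    exact Finset.sum_congr rfl fun j hj => by rw [hBlt j (Finset.mem_range.1 hj)]

lemma add_sq_lt_of_concentration {S a b q r η κ ρ : ℝ} (hη : 40 * η = κ ^ 2) (hκ : 0 < κ)
    (hκρ : κ ≤ ρ ^ 2 / 16) (hρ : 0 < ρ) (hρ' : ρ ≤ 1 / 256) (ha : 0 ≤ a) (hb : 0 ≤ b)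
    (hr : 0 ≤ r) (hqr : ρ ≤ q + r) (h : (1 - 8 * η - κ) ^ 2 ≤ S + (a + b) ^ 2) :
    (1 + 2 * η) ^ 2 < S + q ^ 2 + (a + b + r) ^ 2 := by
  have hκ1 : κ ≤ 1 / 1000000 := by nlinarith
  have hηκ : η ≤ κ / 40 := by nlinarith
  have hη0 : 0 < η := by nlinarith
  have h1 : (a + b) ^ 2 + r ^ 2 ≤ (a + b + r) ^ 2 := by nlinarith [mul_nonneg (add_nonneg ha hb) hr]
  have h2 : ρ ^ 2 / 2 ≤ q ^ 2 + r ^ 2 := by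
    have := pow_le_pow_left₀ hρ.le hqr 2
    nlinarith [sq_nonneg (q - r)]
  have h3 : (1 + 2 * η) ^ 2 < (1 - 8 * η - κ) ^ 2 + ρ ^ 2 / 2 := by nlinarith
  linarith

/-- Consider `x ≪ z ≪ w`, where the suprema of `z` and `w` along zero branches nearly agree. If
`x + z` and `x + w` nearly lie in the unit ball and the norm of `x` is bounded away from one, then
so is the norm of their midpoint. -/
lemma yBound_two_mul_add {x z w : Node →₀ ℝ} {N L M ℓ₀ : ℕ} {η κ ρ : ℝ}
    (hη : 40 * η = κ ^ 2) (hκ : 0 < κ) (hκρ : κ ≤ ρ ^ 2 / 16) (hρ : 0 < ρ) (hρ' : ρ ≤ 1 / 256)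
    (hNM : N ≤ M) (hLM : L ≤ M) (hℓ₀ : ℓ₀ ≤ M)
    (hx : ∀ φ : Node, N < φ.length → x φ = 0) (hzN : ∀ φ : Node, φ.length ≤ N → z φ = 0)
    (hzL : ∀ φ : Node, L < φ.length → z φ = 0) (hw : ∀ φ : Node, φ.length ≤ M → w φ = 0)
    (hx1 : YBound x (1 - 4 * ρ)) (hxz : YBound (x + z) (1 + 2 * η))
    (hxw : YBound (x + w) (1 + 2 * η))
    (hzw : ∑ σ ∈ level ℓ₀, |branchSup w σ - branchSup z σ| ≤ 2 * η)
    (hlevel : ∀ ℓ ≤ L,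
      ∑ σ ∈ level ℓ, branchSup w σ ≤ ∑ σ ∈ level ℓ₀, branchSup w σ + 3 * η) :
    YBound (fun φ => 2 * x φ + z φ + w φ) (2 - 6 * η) := by
  intro A hA k
  by_contra! hlt
  have hκ1 : κ ≤ 1 / 1000000 := by nlinarith
  have hηκ : η ≤ κ / 40 := by nlinarith
  have hη0 : 0 < η := by nlinarith
  have hκρ' : κ ≤ ρ / 16 := by nlinarith
  have habs_z : ∀ φ, |x φ| + |z φ| = |x φ + z φ| := fun φ => by
    rcases le_or_gt φ.length N with h | h
    · simp [hzN φ h]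
    · simp [hx φ h]
  have habs_w : ∀ φ, |x φ| + |w φ| = |x φ + w φ| := fun φ => by
    rcases le_or_gt φ.length M with h | h
    · simp [hw φ h]
    · simp [hx φ (hNM.trans_lt h)]
  have hpos : ∀ (g : Node →₀ ℝ) i, 0 < ∑ φ ∈ A i, |g φ| → ∃ φ ∈ A i, g φ ≠ 0 := by
    intro g i hi
    obtain ⟨φ, hφ, h⟩ := Finset.exists_ne_zero_of_sum_ne_zero hi.ne'
    exact ⟨φ, hφ, by simpa using h⟩
  have hnonneg : ∀ (g : Node →₀ ℝ) (F : Finset Node), 0 ≤ ∑ φ ∈ F, |g φ| :=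
    fun g F => Finset.sum_nonneg fun _ _ => abs_nonneg _
  obtain ⟨i, -, hbi, hci, hmain⟩ := exists_concentration (k := k) (a := fun i => ∑ φ ∈ A i, |x φ|)
    (b := fun i => ∑ φ ∈ A i, |z φ|) (c := fun i => ∑ φ ∈ A i, |w φ|)
    (fun i => hnonneg z _) (fun i => hnonneg w _) hη hκ hκρ hρ hρ' (hx1 A hA k)
    (by simpa only [← Finset.sum_add_distrib, habs_z, chainSum, Pi.add_apply] using hxz A hA k)
    (by simpa only [← Finset.sum_add_distrib, habs_w, chainSum, Pi.add_apply] using hxw A hA k)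
    (hlt.trans_le <| Finset.sum_le_sum fun i _ => by
      refine pow_le_pow_left₀ (Finset.sum_nonneg fun _ _ => abs_nonneg _) ?_ 2
      rw [Finset.mul_sum, ← Finset.sum_add_distrib, ← Finset.sum_add_distrib]
      refine Finset.sum_le_sum fun φ _ => ?_
      refine (abs_add_three _ _ _).trans (le_of_eq ?_)
      rw [abs_mul, abs_two])
    (by
      intro i hb hc
      obtain ⟨φ, hφ, hzφ⟩ := hpos z i hb
      obtain ⟨ψ, hψ, hwψ⟩ := hpos w i hc
      have hφL : φ.length ≤ L := not_lt.1 fun h => hzφ (hzL φ h)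
      have hψM : M < ψ.length := not_le.1 fun h => hwψ (hw ψ h)
      refine ⟨fun j hj => Finset.sum_eq_zero fun χ hχ => ?_, fun j hj =>
        ⟨Finset.sum_eq_zero fun χ hχ => ?_, Finset.sum_eq_zero fun χ hχ => ?_⟩⟩
      · have := hA.2 j i hj χ hχ φ hφ
        rw [hw χ (by omega), abs_zero]
      · have := hA.2 i j hj ψ hψ χ hχ
        rw [hx χ (by omega), abs_zero]
      · have := hA.2 i j hj ψ hψ χ hχ
        rw [hzL χ (by omega), abs_zero])
  obtain ⟨φ₀, hφ₀, hzφ₀⟩ := hpos z i hbi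
  have hφ₀L : φ₀.length ≤ L := not_lt.1 fun h => hzφ₀ (hzL φ₀ h)
  obtain ⟨ℓ, hℓ, hinj⟩ := acceptable_iff.1 (hA.1 i)
  have hℓL : ℓ ≤ L := (hℓ φ₀ hφ₀).1.trans hφ₀L
  obtain ⟨Q, R, hQ, hR, hdisj, hQz, hRz, htransfer⟩ := exists_transfer (by linarith) hℓ hinj
    (hℓL.trans hLM) hℓ₀ (fun φ h => hzL φ (hLM.trans_lt h)) hw hzw (hlevel ℓ hℓL)
  let A' := (A i).filter (·.length ≤ M) ∪ R
  have hzN' : ∀ φ : Node, z φ ≠ 0 → N < φ.length := fun φ h => not_le.1 fun h' => h (hzN φ h')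
  obtain ⟨B, hB, hBsum⟩ := exists_chain_insert hA (N := N) (ℓ := ℓ) (i := i) hQ hR
    (fun φ hφ => ⟨hzN' φ (hQz φ hφ).1, (hQz φ hφ).2⟩) fun φ hφ => by
      rcases Finset.mem_union.1 hφ with h | h
      · exact ⟨(hℓ φ (Finset.mem_filter.1 h).1).1, Or.inl (Finset.mem_filter.1 h).1⟩
      · exact ⟨(hRz φ h).2, Or.inr (hzN' φ (hRz φ h).1)⟩
  have hle_z : ∀ φ, |z φ| ≤ |(x + z) φ| := fun φ => by
    rw [Finsupp.add_apply, ← habs_z]; linarith [abs_nonneg (x φ)]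
  have h_lt : ∑ j ∈ Finset.range i, (∑ φ ∈ A j, |x φ|) ^ 2
      ≤ ∑ j ∈ Finset.range i, (∑ φ ∈ A j with φ.length ≤ N, |(⇑x + ⇑z) φ|) ^ 2 := by
    refine Finset.sum_le_sum fun j _ => pow_le_pow_left₀ (hnonneg x _) ?_ 2
    rw [← Finset.sum_filter_of_ne (p := (·.length ≤ N))]
    · refine Finset.sum_le_sum fun φ _ => ?_
      rw [Pi.add_apply, ← habs_z]
      linarith [abs_nonneg (z φ)]
    · exact fun φ _ h => not_lt.1 fun h' => h (by rw [hx φ h', abs_zero])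
  have h_Q : ∑ φ ∈ Q, |z φ| ≤ ∑ φ ∈ Q, |(⇑x + ⇑z) φ| := Finset.sum_le_sum fun φ _ => hle_z φ
  have h_R : ∑ φ ∈ A i, |x φ| + ∑ φ ∈ A i, |z φ| + ∑ φ ∈ R, |z φ|
      ≤ ∑ φ ∈ A', |(⇑x + ⇑z) φ| := by
    rw [Finset.sum_union hdisj, ← Finset.sum_add_distrib]
    refine add_le_add ?_ (Finset.sum_le_sum fun φ _ => hle_z φ)
    rw [Finset.sum_filter_of_ne]
    · exact Finset.sum_le_sum fun φ _ => (habs_z φ).le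
    · refine fun φ _ h => not_lt.1 fun h' => h ?_
      simp [hx φ (hNM.trans_lt h'), hzL φ (hLM.trans_lt h')]
  have hr0 := hnonneg z R
  have hab0 := add_nonneg (hnonneg x (A i)) (hnonneg z (A i))
  have hqr : ρ ≤ ∑ φ ∈ Q, |z φ| + ∑ φ ∈ R, |z φ| := by linarith
  have hlt' := add_sq_lt_of_concentration hη hκ hκρ hρ hρ' (hnonneg x (A i)) (hnonneg z (A i)) hr0
    hqr hmain
  have hsum := hxz B hB (i + 2)
  rw [hBsum] at hsum
  have h_Q2 := pow_le_pow_left₀ (hnonneg z Q) h_Q 2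
  have h_R2 := pow_le_pow_left₀ (add_nonneg hab0 hr0) h_R 2
  linarith

/-! ### Passage to subsequences -/

section Subsequences

open Filter Topology

lemma exists_subseq_tendsto_pi {ι : Type*} [Countable ι] {g : ℕ → ι → ℝ} {r : ℝ}
    (hg : ∀ n i, |g n i| ≤ r) :
    ∃ (f : ι → ℝ) (s : ℕ → ℕ), StrictMono s ∧ ∀ i, Tendsto (fun n => g (s n) i) atTop (𝓝 (f i)) := by
  obtain ⟨f, -, s, hs, h⟩ := (isCompact_univ_pi fun _ : ι => isCompact_Icc (a := -r) (b := r))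
    |>.tendsto_subseq fun n => fun i _ => abs_le.1 (hg n i)
  exact ⟨f, s, hs, tendsto_pi_nhds.1 h⟩

lemma YBound.of_tendsto {y : ℕ → Node → ℝ} {x : Node → ℝ} {r : ℝ} (hy : ∀ n, YBound (y n) r)
    (h : ∀ φ, Tendsto (fun n => y n φ) atTop (𝓝 (x φ))) : YBound x r := by
  intro A hA k
  refine le_of_tendsto' (f := fun n => chainSum (y n) A k) (x := atTop) ?_ fun n => hy n A hA k
  exact tendsto_finsetSum _ fun i _ => (tendsto_finsetSum _ fun φ _ => (h φ).abs).pow 2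

/-- The finite set of nodes of length at most `n`. -/
noncomputable def levelsUpTo (n : ℕ) : Finset Node := (List.finite_length_le Bool n).toFinset

lemma mem_levelsUpTo {n : ℕ} {φ : Node} : φ ∈ levelsUpTo n ↔ φ.length ≤ n := by simp [levelsUpTo]

lemma eventually_yBound_truncate {g : ℕ → Node → ℝ}
    (hg : ∀ φ, Tendsto (fun n => g n φ) atTop (𝓝 0)) (K : ℕ) {η : ℝ} (hη : 0 < η) :
    ∀ᶠ n in atTop, YBound (fun φ => if φ.length ≤ K then g n φ else 0) η := by
  have hlim : Tendsto (fun n => ∑ φ ∈ levelsUpTo K, |if φ.length ≤ K then g n φ else 0|)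
      atTop (𝓝 0) := by
    rw [← Finset.sum_const_zero (s := levelsUpTo K)]
    refine tendsto_finsetSum _ fun φ hφ => ?_
    simpa [mem_levelsUpTo.1 hφ] using (hg φ).abs
  filter_upwards [hlim.eventually_lt_const hη] with n hn
  refine (yBound_of_support fun φ hφ => if_neg ?_).mono
    (Finset.sum_nonneg fun _ _ => abs_nonneg _) hn.le
  rwa [mem_levelsUpTo] at hφ

/-- The tails of a function satisfying a bound in `Y` tend to zero in norm. -/
lemma YBound.exists_tail {x : Node → ℝ} {r : ℝ} (hx : YBound x r) {η : ℝ} (hη : 0 < η) :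
    ∃ N : ℕ, YBound (fun φ => if φ.length ≤ N then 0 else x φ) η := by
  let S : Set ℝ := {t | ∃ A, AcceptableChain A ∧ ∃ k, t = chainSum x A k}
  have hS : BddAbove S := ⟨r ^ 2, by rintro _ ⟨A, hA, k, rfl⟩; exact hx A hA k⟩
  have hne : S.Nonempty := ⟨_, fun _ => ∅, ⟨fun _ => acceptable_empty, by simp [Before]⟩, 0, rfl⟩
  obtain ⟨_, ⟨A, hA, k, rfl⟩, hlt⟩ := exists_lt_of_lt_csSup hne (sub_lt_self (sSup S) (pow_pos hη 2))
  let N := ((Finset.range k).biUnion A).sup List.length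
  refine ⟨N, fun B hB l => ?_⟩
  obtain ⟨C, hC, m, h⟩ := exists_chain_append x N hA hB k l
  have hle := le_csSup hS ⟨C, hC, m, rfl⟩
  have hA_eq : chainSum (fun φ => if φ.length ≤ N then x φ else 0) A k = chainSum x A k := by
    refine Finset.sum_congr rfl fun i hi => ?_
    congr 1
    refine Finset.sum_congr rfl fun φ hφ => ?_
    dsimp only
    rw [if_pos (Finset.le_sup (f := List.length) (Finset.mem_biUnion.2 ⟨i, hi, hφ⟩))]
  linarith

/-- Every sequence in the unit ball has a subsequence that, up to a small error, is of the form
`x + zₙ` with `x ≪ zₙ` and `zₙ` supported on nodes of length tending to infinity. -/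
lemma exists_block_subseq {y : ℕ → Node →₀ ℝ} (hy : ∀ n, YBound (y n) 1) {η : ℝ} (hη : 0 < η) :
    ∃ (N : ℕ) (x : Node →₀ ℝ) (s : ℕ → ℕ) (z : ℕ → Node →₀ ℝ), StrictMono s ∧
      (∀ φ : Node, N < φ.length → x φ = 0) ∧ (∀ n, ∀ φ : Node, φ.length ≤ max n N → z n φ = 0) ∧
      (∀ n, YBound (z n) 1) ∧ ∀ n, YBound (y (s n) - (x + z n)) (2 * η) := by
  have hpt : ∀ n φ, |y n φ| ≤ 1 := fun n φ => by
    simpa using (hy n).sum_le zero_le_one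
      (acceptable_image (n := φ.length) (H := {φ}) (by simp) fun _ => 0)
  obtain ⟨x, s, hs, hlim⟩ := exists_subseq_tendsto_pi hpt
  obtain ⟨N, hN⟩ := (YBound.of_tendsto (fun n => hy (s n)) hlim).exists_tail hη
  obtain ⟨t, ht, hclose⟩ := extraction_forall_of_eventually fun n =>
    eventually_yBound_truncate (g := fun k φ => y (s k) φ - x φ)
      (fun φ => by simpa using (hlim φ).sub_const (x φ)) (max n N) hη
  refine ⟨N, Finsupp.onFinset (levelsUpTo N) (fun φ => if φ.length ≤ N then x φ else 0)
      fun φ h => mem_levelsUpTo.2 (by by_contra h'; simp [h'] at h), s ∘ t,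
    fun n => (y (s (t n))).filter fun φ => max n N < φ.length, hs.comp ht, ?_, ?_, ?_, ?_⟩
  · intro φ hφ
    simp [hφ]
  · intro n φ hφ
    exact Finsupp.filter_apply_neg _ _ hφ.not_gt
  · intro n
    refine (hy (s (t n))).of_abs_le fun φ => ?_
    rw [Finsupp.filter_apply]
    split_ifs <;> simp
  · intro n
    rw [two_mul]
    refine ((hclose n).add hη.le hη.le hN).of_abs_le fun φ => ?_
    simp only [Function.comp_apply, Pi.sub_apply, Pi.add_apply, Finsupp.onFinset_apply,
      Finsupp.filter_apply]
    by_cases h₁ : φ.length ≤ N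
    · have h₂ : φ.length ≤ max n N := h₁.trans (le_max_right _ _)
      simp [h₁, not_lt.2 h₂, h₂]
    · by_cases h₂ : φ.length ≤ max n N
      · rw [if_neg h₁, if_neg h₂.not_gt, if_pos h₂, if_neg h₁]
        exact le_of_eq (by congr 1; ring)
      · rw [if_neg h₁, if_pos (not_le.1 h₂), if_neg h₂, if_neg h₁, zero_add, sub_self, abs_zero]
        exact abs_nonneg _

/-- In a sequence `zₙ` in the unit ball with supports tending to infinity there are two elements
whose suprema along zero branches are nearly equal, and nearly exhausted by those of some level. -/
lemma exists_pair_branchSup {z : ℕ → Node →₀ ℝ} (hz : ∀ n, YBound (z n) 1) {η : ℝ} (hη : 0 < η) :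
    ∃ m n L ℓ₀ : ℕ, m < n ∧ L ≤ n ∧ ℓ₀ ≤ n ∧ (∀ φ : Node, L < φ.length → z m φ = 0) ∧
      ∑ σ ∈ level ℓ₀, |branchSup (z n) σ - branchSup (z m) σ| ≤ 2 * η ∧
      ∀ ℓ ≤ L, ∑ σ ∈ level ℓ, branchSup (z n) σ
        ≤ ∑ σ ∈ level ℓ₀, branchSup (z n) σ + 3 * η := by
  have hbd : ∀ n σ, |branchSup (z n) σ| ≤ 1 := fun n σ => by
    rw [abs_of_nonneg (branchSup_nonneg _ _)]
    exact (Finset.single_le_sum (fun τ _ => branchSup_nonneg (z n) τ)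
      (mem_level.2 (rfl : σ.length = _))).trans ((hz n).sum_branchSup_le zero_le_one _)
  obtain ⟨f, s, hs, hlim⟩ := exists_subseq_tendsto_pi hbd
  have hsum_lim : ∀ ℓ, Tendsto (fun n => ∑ σ ∈ level ℓ, |branchSup (z (s n)) σ - f σ|)
      atTop (𝓝 0) := fun ℓ => by
    rw [← Finset.sum_const_zero (s := level ℓ)]
    exact tendsto_finsetSum _ fun σ _ => by simpa using ((hlim σ).sub_const (f σ)).abs
  have hclose : ∀ ℓ, ∀ᶠ n in atTop, ∑ σ ∈ level ℓ, |branchSup (z (s n)) σ - f σ| ≤ η := fun ℓ =>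
    ((hsum_lim ℓ).eventually_lt_const hη).mono fun _ h => h.le
  have hf : BddAbove (Set.range fun ℓ => ∑ σ ∈ level ℓ, f σ) := by
    refine ⟨1, ?_⟩
    rintro _ ⟨ℓ, rfl⟩
    exact le_of_tendsto' (tendsto_finsetSum _ fun σ _ => hlim σ)
      fun n => (hz (s n)).sum_branchSup_le zero_le_one ℓ
  obtain ⟨ℓ₀, hℓ₀⟩ := exists_lt_of_lt_ciSup (sub_lt_self (⨆ ℓ, ∑ σ ∈ level ℓ, f σ) hη)
  obtain ⟨m, hm⟩ := (hclose ℓ₀).exists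
  let L := (z (s m)).support.sup List.length
  have hL : ∀ φ : Node, L < φ.length → z (s m) φ = 0 := fun φ hφ => by
    by_contra h
    exact hφ.not_ge (Finset.le_sup (f := List.length) (Finsupp.mem_support_iff.2 h))
  obtain ⟨n, hn, hn₀, hnm, hnL, hnℓ₀⟩ := (((Finset.range (L + 1)).eventually_all.2
    fun ℓ _ => hclose ℓ).and <| (hclose ℓ₀).and <| (eventually_gt_atTop m).and <|
    (eventually_ge_atTop L).and <| eventually_ge_atTop ℓ₀).exists
  refine ⟨s m, s n, L, ℓ₀, hs hnm, hnL.trans (hs.id_le n), hnℓ₀.trans (hs.id_le n), hL, ?_,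
    fun ℓ hℓ => ?_⟩
  · calc _ ≤ ∑ σ ∈ level ℓ₀, (|branchSup (z (s n)) σ - f σ| + |branchSup (z (s m)) σ - f σ|) := by
          gcongr with σ
          rw [abs_sub_comm (branchSup (z (s m)) σ)]
          exact abs_sub_le _ _ _
      _ ≤ _ := by rw [Finset.sum_add_distrib]; linarith
  · have h₁ := hn ℓ (Finset.mem_range_succ_iff.2 hℓ)
    have h₂ := le_ciSup hf ℓ
    have h₃ : ∑ σ ∈ level ℓ, branchSup (z (s n)) σ - ∑ σ ∈ level ℓ, f σ ≤ η := by
      rw [← Finset.sum_sub_distrib]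
      exact (Finset.sum_le_sum fun _ _ => le_abs_self _).trans h₁
    have h₄ : ∑ σ ∈ level ℓ₀, f σ - ∑ σ ∈ level ℓ₀, branchSup (z (s n)) σ ≤ η := by
      rw [← Finset.sum_sub_distrib]
      refine (Finset.sum_le_sum fun _ _ => ?_).trans hn₀
      rw [abs_sub_comm]
      exact le_abs_self _
    linarith

end Subsequences

/-! ### The main estimate -/

/-- If `x` can be prolonged by some `z` of norm larger than `ε / 4` without exceeding norm
`1 + 2 * η`, then the norm of `x` is smaller than `1` by an amount that depends only on `ε`. -/
lemma YBound.of_add_of_not {x z : Node →₀ ℝ} {N : ℕ} {ε η ρ : ℝ} (hρ : 256 * ρ = ε ^ 2)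
    (hη : 0 < η) (hηρ : η ≤ ρ / 2)
    (hx : ∀ φ : Node, N < φ.length → x φ = 0) (hz : ∀ φ : Node, φ.length ≤ N → z φ = 0)
    (hxz : YBound (x + z) (1 + 2 * η)) (h : ¬ YBound z (ε / 4)) : YBound x (1 - 4 * ρ) := by
  intro A hA k
  unfold YBound at h
  push Not at h
  obtain ⟨B, hB, l, h⟩ := h
  obtain ⟨C, hC, m, h'⟩ := exists_chain_append (x + z) N hA hB k l
  have hx' : chainSum x A k ≤
      chainSum (fun φ => if φ.length ≤ N then (x + z : Node → ℝ) φ else 0) A k :=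
    chainSum_mono (fun φ => by
      split_ifs with hφ
      · simp [hz φ hφ]
      · simp [hx φ (not_le.1 hφ)]) A k
  have hz' : chainSum z B l ≤
      chainSum (fun φ => if φ.length ≤ N then 0 else (x + z : Node → ℝ) φ) B l :=
    chainSum_mono (fun φ => by
      split_ifs with hφ
      · simp [hz φ hφ]
      · simp [hx φ (not_le.1 hφ)]) B l
  have := hxz C hC m
  nlinarith

/-- The norm of `Y` is `2`-NUC on `c₀₀(T)`. -/
lemma exists_normY_add_le {ε : ℝ} (hε : 0 < ε) (hε' : ε ≤ 1) : ∃ δ : ℝ, 0 < δ ∧ δ < 1 ∧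
    ∀ y : ℕ → Node →₀ ℝ, (∀ n, normY (y n) ≤ 1) → SeparatedWith normY ε y →
      ∃ i k : ℕ, i < k ∧ normY (y i + y k) ≤ 2 - 2 * δ := by
  obtain ⟨ρ, hρ⟩ : ∃ ρ, 256 * ρ = ε ^ 2 := ⟨ε ^ 2 / 256, by ring⟩
  obtain ⟨κ, hκ⟩ : ∃ κ, κ = ρ ^ 2 / 16 := ⟨_, rfl⟩
  obtain ⟨η, hη⟩ : ∃ η, 40 * η = κ ^ 2 := ⟨κ ^ 2 / 40, by ring⟩
  have hρ₀ : 0 < ρ := by nlinarith [pow_pos hε 2]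
  have hρ₁ : ρ ≤ 1 / 256 := by nlinarith
  have hκ₀ : 0 < κ := by rw [hκ]; positivity
  have hκ₁ : κ ≤ ρ := by rw [hκ]; nlinarith
  have hη₀ : 0 < η := by nlinarith [pow_pos hκ₀ 2]
  have hηρ : η ≤ ρ / 2 := by nlinarith
  have hηε : η < ε / 8 := by nlinarith
  refine ⟨η, hη₀, by linarith, fun y hy hsep => ?_⟩
  have hy' : ∀ n, YBound (y n) 1 := fun n => (normY_le_iff zero_le_one).1 (hy n)
  obtain ⟨N, x, s, z, hs, hx, hz, hz₁, he⟩ := exists_block_subseq hy' hη₀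
  have hzN : ∀ n, ∀ φ : Node, φ.length ≤ N → z n φ = 0 := fun n φ hφ =>
    hz n φ (hφ.trans (le_max_right _ _))
  have hη₂ : (0 : ℝ) ≤ 2 * η := by linarith
  have hxz : ∀ n, YBound (x + z n) (1 + 2 * η) := fun n => by
    simpa using (hy' (s n)).sub zero_le_one hη₂ (he n)
  have hlarge : ∃ n, ¬ YBound (z n) (ε / 4) := by
    by_contra! h
    have hle : normY (y (s 0) - y (s 1)) ≤ (ε / 4 + ε / 4) + (2 * η + 2 * η) := by
      rw [normY_le_iff (by linarith)]
      refine (((h 0).sub (by linarith) (by linarith) (h 1)).add (by linarith) (by linarith)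
        ((he 0).sub hη₂ hη₂ (he 1))).of_abs_le fun φ => le_of_eq ?_
      simp only [Finsupp.sub_apply, Pi.add_apply, Pi.sub_apply]
      congr 1
      ring
    have := hsep (s 0) (s 1) (hs.injective.ne zero_ne_one)
    linarith
  obtain ⟨n₀, hn₀⟩ := hlarge
  have hx₁ : YBound x (1 - 4 * ρ) := YBound.of_add_of_not hρ hη₀ hηρ hx (hzN n₀) (hxz n₀) hn₀
  obtain ⟨m, n, L, ℓ₀, hmn, hL, hℓ₀, hzL, hzw, hlevel⟩ := exists_pair_branchSup hz₁ hη₀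
  refine ⟨s m, s n, hs hmn, ?_⟩
  have hmain := yBound_two_mul_add hη hκ₀ hκ.le hρ₀ hρ₁ (le_max_right n N)
    (hL.trans (le_max_left n N)) (hℓ₀.trans (le_max_left n N)) hx (hzN m) hzL (hz n) hx₁
    (hxz m) (hxz n) hzw hlevel
  rw [normY_le_iff (by linarith), show 2 - 2 * η = 2 - 6 * η + (2 * η + 2 * η) by ring]
  refine (hmain.add (by linarith) (by linarith) ((he m).add hη₂ hη₂ (he n))).of_abs_le
    fun φ => le_of_eq ?_
  simp only [Finsupp.add_apply, Pi.add_apply, Pi.sub_apply]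
  congr 1
  ring

/-- **Proposition 3.** The space `Y` — the completion of `c₀₀(T)` under `‖·‖_Y`,
here represented by any Banach space `Y` together with a dense linear isometry `j`
from `(c₀₀(T), ‖·‖_Y)` — is `2`-NUC. -/
theorem Y_two_NUC
    (Y : Type*) [NormedAddCommGroup Y] [NormedSpace ℝ Y] [CompleteSpace Y]
    (j : (Node →₀ ℝ) →ₗ[ℝ] Y) (hdense : DenseRange j)
    (hiso : ∀ y : Node →₀ ℝ, ‖j y‖ = normY y) :
    ∀ ε : ℝ, 0 < ε → ∃ δ : ℝ, 0 < δ ∧ δ < 1 ∧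
      ∀ u : ℕ → Y, (∀ n, ‖u n‖ ≤ 1) → Separated ε u →
        ∃ n₁ n₂ : ℕ, n₁ < n₂ ∧ ‖u n₁ + u n₂‖ / 2 ≤ 1 - δ := by
  intro ε hε
  obtain ⟨δ, hδ, hδ', hmain⟩ := exists_normY_add_le (ε := min (ε / 2) 1) (by positivity)
    (min_le_right _ _)
  refine ⟨δ / 2, by linarith, by linarith, fun u hu hsep => ?_⟩
  obtain ⟨τ, hτ, hτδ, hτε⟩ : ∃ τ, 0 < τ ∧ τ ≤ δ / 4 ∧ τ ≤ ε / 8 :=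
    ⟨min (δ / 4) (ε / 8), by positivity, min_le_left _ _, min_le_right _ _⟩
  have happrox : ∀ n, ∃ y, ‖j y‖ ≤ 1 ∧ ‖u n - j y‖ ≤ 2 * τ := fun n => by
    obtain ⟨y, hy⟩ := hdense.exists_dist_lt ((1 - τ) • u n) hτ
    rw [dist_eq_norm] at hy
    have h₁ : ‖(1 - τ) • u n‖ ≤ 1 - τ := by
      rw [norm_smul, Real.norm_of_nonneg (by linarith)]
      exact mul_le_of_le_one_right (by linarith) (hu n)
    have h₂ : ‖τ • u n‖ ≤ τ := by
      rw [norm_smul, Real.norm_of_nonneg hτ.le]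
      exact mul_le_of_le_one_right hτ.le (hu n)
    refine ⟨y, ?_, ?_⟩
    · have := norm_le_norm_add_norm_sub ((1 - τ) • u n) (j y)
      linarith
    · have h₃ := norm_add_le (τ • u n) ((1 - τ) • u n - j y)
      rw [show τ • u n + ((1 - τ) • u n - j y) = u n - j y by module] at h₃
      linarith
  choose y hy₁ hy using happrox
  obtain ⟨i, k, hik, h⟩ := hmain y (fun n => hiso (y n) ▸ hy₁ n) fun m n hmn => by
    have h₁ := hsep m n hmn
    have h₂ := norm_add₃_le (a := u m - j (y m)) (b := j (y m) - j (y n)) (c := -(u n - j (y n)))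
    rw [norm_neg, show u m - j (y m) + (j (y m) - j (y n)) + -(u n - j (y n)) = u m - u n by abel,
      ← map_sub, hiso] at h₂
    have := hy m
    have := hy n
    exact (min_le_left _ _).trans (by linarith)
  refine ⟨i, k, hik, ?_⟩
  have h₂ := norm_add₃_le (a := u i - j (y i)) (b := j (y i) + j (y k)) (c := u k - j (y k))
  rw [show u i - j (y i) + (j (y i) + j (y k)) + (u k - j (y k)) = u i + u k by abel,
    ← map_add, hiso] at h₂
  have := hy i
  have := hy k
  linarith
end
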